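/- arXiv:2404.04058 — 6 statements merged into one kernel-verified Lean document; each statement's English description precedes it below -/
import Mathlib

section
/- For all integers n ≥ 2, the number A_n of complete non-ambiguous trees of size n with determinant 1 satisfies the recurrence A_n = Σ_{k=1}^{n-1} [ (A_k·A_{n-k} + B_k·B_{n-k})·(e^{n-1}_{k-1}·e^{n-1}_k + o^{n-1}_{k-1}·o^{n-1}_k) + (A_k·B_{n-k} + B_k·A_{n-k})·(e^{n-1}_{k-1}·o^{n-1}_k + o^{n-1}_{k-1}·e^{n-1}_k) ]. -/
/-- A complete non-ambiguous tree (CNAT) of size `n`: a dotted filling of the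
`n × n` grid (`dot i j = true` means cell in row `i`, column `j` is dotted)
such that the top-left cell (the root) is dotted; every other dotted cell
(vertex) has another vertex either above it in the same column, or to its left
in the same row, but not both; every row and column contains a vertex; and the
underlying rooted binary tree is complete, i.e. every vertex has either both a
child below it in its column and a child to its right in its row, or neither. -/
structure CNAT (n : ℕ) where
  dot : Fin n → Fin n → Bool
  root : ∀ h : 0 < n, dot ⟨0, h⟩ ⟨0, h⟩ = true
  nonambiguous : ∀ i j : Fin n, dot i j = true → ¬((i : ℕ) = 0 ∧ (j : ℕ) = 0) →
    Xor' (∃ i' : Fin n, i' < i ∧ dot i' j = true)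
         (∃ j' : Fin n, j' < j ∧ dot i j' = true)
  min_row : ∀ i : Fin n, ∃ j : Fin n, dot i j = true
  min_col : ∀ j : Fin n, ∃ i : Fin n, dot i j = true
  complete : ∀ i j : Fin n, dot i j = true →
    ((∃ i' : Fin n, i < i' ∧ dot i' j = true) ↔ (∃ j' : Fin n, j < j' ∧ dot i j' = true))

/-- The determinant of a CNAT viewed as a 0-1 matrix. -/
noncomputable def cnatDet {n : ℕ} (M : CNAT n) : ℤ :=
  Matrix.det (Matrix.of fun i j => if M.dot i j then (1 : ℤ) else 0)

/-- `cnatA n` is the number of CNATs of size `n` with determinant `1`. -/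
noncomputable def cnatA (n : ℕ) : ℕ := Nat.card {M : CNAT n // cnatDet M = 1}

/-- `cnatB n` is the number of CNATs of size `n` with determinant `-1`. -/
noncomputable def cnatB (n : ℕ) : ℕ := Nat.card {M : CNAT n // cnatDet M = -1}

/-- `cnatT n = cnatA n + cnatB n` is the total number of CNATs of size `n`. -/
noncomputable def cnatT (n : ℕ) : ℕ := cnatA n + cnatB n

/-- The defect `D n = A n - B n`. -/
noncomputable def cnatD (n : ℕ) : ℤ := (cnatA n : ℤ) - (cnatB n : ℤ)

/-- `eCount m k` is the number of `k`-element subsets of `{1, …, m}` with even sum. -/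
def eCount (m k : ℕ) : ℕ :=
  ((Finset.powersetCard k (Finset.Icc 1 m)).filter fun S => Even (S.sum id)).card

/-- `oCount m k` is the number of `k`-element subsets of `{1, …, m}` with odd sum. -/
def oCount (m k : ℕ) : ℕ :=
  ((Finset.powersetCard k (Finset.Icc 1 m)).filter fun S => Odd (S.sum id)).card

open Finset in
theorem cn_sign {k l : ℕ} (e : Fin k ⊕ Fin l ≃ Fin (k + l))
    (el : ∀ a b, e (Sum.inl a) < e (Sum.inl b) ↔ a < b)
    (er : ∀ a b, e (Sum.inr a) < e (Sum.inr b) ↔ a < b) :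
    ((Equiv.Perm.sign (finSumFinEquiv.symm.trans e) : ℤˣ) : ℤ) * (-1) ^ (∑ a : Fin k, (a : ℕ)) =
      (-1) ^ (∑ a : Fin k, (e (Sum.inl a) : ℕ)) := by
  have h1 : Equiv.Perm.sign (finSumFinEquiv.symm.trans e) =
      ∏ x : Fin k ⊕ Fin l, ∏ y : Fin k ⊕ Fin l,
        if finSumFinEquiv x < finSumFinEquiv y then (if e x < e y then (1 : ℤˣ) else -1) else 1 := by
    rw [Equiv.Perm.sign_eq_prod_prod_Ioi, ← finSumFinEquiv.prod_comp]
    refine prod_congr rfl fun x _ => ?_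
    have hq := finSumFinEquiv.prod_comp (fun j => if finSumFinEquiv x < j then
      (if e x < e (finSumFinEquiv.symm j) then (1 : ℤˣ) else -1) else 1)
    simp only [Equiv.symm_apply_apply] at hq
    rw [hq, ← prod_filter]
    refine prod_congr (by ext; simp) fun y _ => by simp
  have h2 : Equiv.Perm.sign (finSumFinEquiv.symm.trans e) =
      ∏ a : Fin k, ∏ b : Fin l, if e (Sum.inl a) < e (Sum.inr b) then (1 : ℤˣ) else -1 := by
    rw [h1, Fintype.prod_sum_type]
    have hx : ∀ (a : Fin k) (b : Fin l), finSumFinEquiv (Sum.inl a : Fin k ⊕ Fin l)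
        < finSumFinEquiv (Sum.inr b) := by
      intro a b; simp [Fin.lt_def]; omega
    rw [Finset.prod_eq_one (s := (univ : Finset (Fin l)))]
    · rw [mul_one]
      refine prod_congr rfl fun a _ => ?_
      rw [Fintype.prod_sum_type, Finset.prod_eq_one, one_mul]
      · refine prod_congr rfl fun b _ => ?_
        rw [if_pos (hx a b)]
      · intro b _
        simp only [el, finSumFinEquiv_apply_left, Fin.lt_def, Fin.val_castAdd]
        split_ifs <;> rfl
    · intro a _
      rw [Fintype.prod_sum_type, Finset.prod_eq_one, Finset.prod_eq_one, one_mul]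
      · intro b _
        simp only [er, finSumFinEquiv_apply_right, Fin.lt_def, Fin.val_natAdd]
        split_ifs <;> first | rfl | omega
      · intro b _
        rw [if_neg (not_lt_of_gt (hx b a))]
  have h3 : ∀ a : Fin k, (∏ b : Fin l, if e (Sum.inl a) < e (Sum.inr b) then (1 : ℤˣ) else -1)
      * (-1) ^ (a : ℕ) = (-1) ^ (e (Sum.inl a) : ℕ) := by
    intro a
    have hc : (e (Sum.inl a) : ℕ) =
        #{b : Fin l | ¬ e (Sum.inl a) < e (Sum.inr b)} + (a : ℕ) := by
      have t1 : (e (Sum.inl a) : ℕ) = #{x : Fin k ⊕ Fin l | e x < e (Sum.inl a)} := by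
        rw [← Fin.card_Iio (e (Sum.inl a)), ← card_map e.toEmbedding]
        congr 1
        ext y
        simp [Finset.mem_map_equiv]
      rw [t1, ← Finset.card_toLeft_add_card_toRight, add_comm]
      congr 1
      · congr 1
        ext b
        have : e (Sum.inl a) ≠ e (Sum.inr b) := fun h => by simpa using e.injective h
        simp only [mem_toRight, mem_filter, mem_univ, true_and, not_lt]
        exact ⟨le_of_lt, fun h => lt_of_le_of_ne h this.symm⟩
      · conv_rhs => rw [← Fin.card_Iio a]
        congr 1
        ext b
        simp [el]
    rw [prod_ite, prod_const_one, one_mul, prod_const, ← pow_add, hc]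
  rw [h2]
  have h4 : (∏ a : Fin k, ∏ b : Fin l, if e (Sum.inl a) < e (Sum.inr b) then (1 : ℤˣ) else -1)
      * (-1) ^ (∑ a : Fin k, (a : ℕ)) = (-1) ^ (∑ a : Fin k, (e (Sum.inl a) : ℕ)) := by
    rw [← prod_pow_eq_pow_sum, ← prod_pow_eq_pow_sum, ← prod_mul_distrib]
    exact prod_congr rfl fun a _ => h3 a
  have := congrArg (fun u : ℤˣ => (u : ℤ)) h4
  push_cast at this ⊢
  exact this

theorem cn_det {k l : ℕ} (e f : Fin k ⊕ Fin l ≃ Fin (k + l))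
    (el : ∀ a b, e (Sum.inl a) < e (Sum.inl b) ↔ a < b)
    (er : ∀ a b, e (Sum.inr a) < e (Sum.inr b) ↔ a < b)
    (fl : ∀ a b, f (Sum.inl a) < f (Sum.inl b) ↔ a < b)
    (fr : ∀ a b, f (Sum.inr a) < f (Sum.inr b) ↔ a < b)
    (M : Matrix (Fin (k + l)) (Fin (k + l)) ℤ)
    (h12 : ∀ a b, M (e (Sum.inl a)) (f (Sum.inr b)) = 0) :
    M.det = (-1) ^ (∑ a : Fin k, (e (Sum.inl a) : ℕ)) * (-1) ^ (∑ a : Fin k, (f (Sum.inl a) : ℕ)) *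
      ((Matrix.of fun a b => M (e (Sum.inl a)) (f (Sum.inl b))).det *
       (Matrix.of fun a b => M (e (Sum.inr a)) (f (Sum.inr b))).det) := by
  have h : (M.submatrix e f).det = (Matrix.of fun a b => M (e (Sum.inl a)) (f (Sum.inl b))).det *
       (Matrix.of fun a b => M (e (Sum.inr a)) (f (Sum.inr b))).det := by
    rw [← Matrix.det_fromBlocks_zero₁₂ _
      (Matrix.of fun a b => M (e (Sum.inr a)) (f (Sum.inl b)))]
    congr 1
    ext x y
    rcases x with x | x <;> rcases y with y | y <;> simp [h12]
  rw [← h]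
  have h2 : M.submatrix e f =
      (((M.submatrix (finSumFinEquiv.symm.trans e) id).submatrix id (finSumFinEquiv.symm.trans f))).submatrix
        finSumFinEquiv finSumFinEquiv := by
    ext x y; simp
  rw [h2, Matrix.det_submatrix_equiv_self, Matrix.det_permute', Matrix.det_permute]
  rw [← cn_sign e el er, ← cn_sign f fl fr]
  have q1 : ∀ u : ℤˣ, ((u : ℤ)) * u = 1 := fun u => by
    rcases Int.units_eq_one_or u with h | h <;> simp [h]
  have q2 : ((-1 : ℤ) ^ (∑ a : Fin k, (a : ℕ))) * ((-1) ^ (∑ a : Fin k, (a : ℕ))) = 1 := by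
    rw [← pow_add]; exact Even.neg_one_pow ⟨_, rfl⟩
  generalize (-1 : ℤ) ^ (∑ a : Fin k, (a : ℕ)) = s at *
  have q3 := q1 (Equiv.Perm.sign (finSumFinEquiv.symm.trans e))
  have q4 := q1 (Equiv.Perm.sign (finSumFinEquiv.symm.trans f))
  generalize ((Equiv.Perm.sign (finSumFinEquiv.symm.trans e) : ℤˣ) : ℤ) = u at *
  generalize ((Equiv.Perm.sign (finSumFinEquiv.symm.trans f) : ℤˣ) : ℤ) = v at *
  linear_combination (-M.det) * (u * u * v * v * q2 + v * v * q3 + q4)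

structure IsCN {n : ℕ} [NeZero n] (d : Fin n → Fin n → Bool) : Prop where
  root : d 0 0 = true
  nonamb : ∀ i j : Fin n, d i j = true → ¬(i = 0 ∧ j = 0) →
    Xor' (∃ i' : Fin n, i' < i ∧ d i' j = true)
         (∃ j' : Fin n, j' < j ∧ d i j' = true)
  min_row : ∀ i : Fin n, ∃ j : Fin n, d i j = true
  min_col : ∀ j : Fin n, ∃ i : Fin n, d i j = true
  complete : ∀ i j : Fin n, d i j = true →
    ((∃ i' : Fin n, i < i' ∧ d i' j = true) ↔ (∃ j' : Fin n, j < j' ∧ d i j' = true))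

/-- Transposition. -/
theorem IsCN.swap {n : ℕ} [NeZero n] {d : Fin n → Fin n → Bool} (h : IsCN d) :
    IsCN (fun i j => d j i) where
  root := h.root
  nonamb i j hd hn := (h.nonamb j i hd (fun hh => hn hh.symm)).symm
  min_row := h.min_col
  min_col := h.min_row
  complete i j hd := (h.complete j i hd).symm

theorem cn_pos {n : ℕ} [NeZero n] {a : Fin n} (h : a ≠ 0) : 0 < a :=
  lt_of_le_of_ne (by rw [Fin.le_def]; simp) h.symm

theorem cn_exists_first {n : ℕ} (P : Fin n → Prop) (h : ∃ i, P i) :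
    ∃ i, P i ∧ ∀ j, j < i → ¬ P j := by
  obtain ⟨i, hi, hm⟩ := WellFounded.has_min (wellFounded_lt (α := Fin n)) {i | P i} h
  exact ⟨i, hi, fun j hj hp => hm j hp hj⟩

theorem cn_exists_last {n : ℕ} (P : Fin n → Prop) (h : ∃ i, P i) :
    ∃ i, P i ∧ ∀ j, i < j → ¬ P j := by
  obtain ⟨i, hi, hm⟩ := WellFounded.has_min (wellFounded_gt (α := Fin n)) {i | P i} h
  exact ⟨i, hi, fun j hj hp => hm j hp hj⟩

theorem IsCN.first_row {n : ℕ} [NeZero n] {d : Fin n → Fin n → Bool} (h : IsCN d)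
    (i : Fin n) (hi : i ≠ 0) : ∃ j, d i j = true ∧ (∀ j', j' < j → ¬ d i j' = true) ∧
      ∃ i', i' < i ∧ d i' j = true := by
  obtain ⟨j, hj, hm⟩ := cn_exists_first (fun j => d i j = true) (h.min_row i)
  refine ⟨j, hj, hm, ?_⟩
  rcases h.nonamb i j hj (fun hh => hi hh.1) with h1 | h1
  · exact h1.1
  · obtain ⟨⟨j', h1, h2⟩, -⟩ := h1
    exact absurd h2 (hm j' h1)

/-- Colouring compatibility. -/
structure Compat {n : ℕ} [NeZero n] (d : Fin n → Fin n → Bool) (I J : Finset (Fin n)) : Prop where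
  zI : 0 ∉ I
  zJ : 0 ∈ J
  compat : ∀ i j, d i j = true → ¬(i = 0 ∧ j = 0) → (i ∈ I ↔ j ∈ J)

inductive Lc {n : ℕ} [NeZero n] (d : Fin n → Fin n → Bool) : Fin n ⊕ Fin n → Prop
  | base : Lc d (Sum.inr 0)
  | row (i j : Fin n) : d i j = true → ¬(i = 0 ∧ j = 0) → (∀ j', j' < j → ¬ d i j' = true) →
      Lc d (Sum.inr j) → Lc d (Sum.inl i)
  | col (i j : Fin n) : d i j = true → ¬(i = 0 ∧ j = 0) → (∀ i', i' < i → ¬ d i' j = true) →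
      Lc d (Sum.inl i) → Lc d (Sum.inr j)

theorem IsCN.exists_compat {n : ℕ} [NeZero n] {d : Fin n → Fin n → Bool} (h : IsCN d) :
    ∃ I J, Compat d I J := by
  classical
  refine ⟨Finset.univ.filter fun i => Lc d (Sum.inl i),
    Finset.univ.filter fun i => Lc d (Sum.inr i), ?_, ?_, ?_⟩
  · simp only [Finset.mem_filter, Finset.mem_univ, true_and]
    intro hL
    cases hL with
    | row _ j h1 h2 h3 h4 =>
      refine h3 0 ?_ h.root
      exact cn_pos (fun hj => h2 ⟨rfl, hj⟩)
  · simp only [Finset.mem_filter, Finset.mem_univ, true_and]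
    exact Lc.base
  · intro i j hd hn
    simp only [Finset.mem_filter, Finset.mem_univ, true_and]
    rcases h.nonamb i j hd hn with ⟨h1, h2⟩ | ⟨h1, h2⟩
    · push Not at h2
      constructor
      · intro hL
        cases hL with
        | row _ j' k1 k2 k3 k4 =>
          have : j' = j := by
            rcases lt_trichotomy j' j with q | q | q
            · exact absurd k1 (h2 j' q)
            · exact q
            · exact absurd hd (k3 j q)
          exact this ▸ k4
      · exact Lc.row i j hd hn h2
    · push Not at h2
      constructor
      · exact Lc.col i j hd hn h2
      · intro hL
        cases hL with
        | base =>
          obtain ⟨j', q, _⟩ := h1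
          exact absurd q (Fin.not_lt_zero j')
        | col i' _ k1 k2 k3 k4 =>
          have : i' = i := by
            rcases lt_trichotomy i' i with q | q | q
            · exact absurd k1 (h2 i' q)
            · exact q
            · exact absurd hd (k3 i q)
          exact this ▸ k4

theorem IsCN.compat_unique {n : ℕ} [NeZero n] {d : Fin n → Fin n → Bool} (h : IsCN d)
    {I J I' J' : Finset (Fin n)} (c : Compat d I J) (c' : Compat d I' J') : I = I' ∧ J = J' := by
  have hI : ∀ i, i ∈ I ↔ i ∈ I' := by
    intro i
    induction i using WellFoundedLT.induction with
    | ind i ih =>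
      by_cases hi : i = 0
      · subst hi; simp [c.zI, c'.zI]
      · obtain ⟨j, hj, hm, i', hi', hd'⟩ := h.first_row i hi
        rw [c.compat i j hj (fun hh => hi hh.1), c'.compat i j hj (fun hh => hi hh.1)]
        by_cases hj0 : j = 0
        · subst hj0; simp [c.zJ, c'.zJ]
        · rw [← c.compat i' j hd' (fun hh => hj0 hh.2), ← c'.compat i' j hd' (fun hh => hj0 hh.2)]
          exact ih i' hi'
  refine ⟨Finset.ext hI, Finset.ext fun j => ?_⟩
  by_cases hj0 : j = 0
  · subst hj0; simp [c.zJ, c'.zJ]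
  · obtain ⟨i, hi⟩ := h.min_col j
    rw [← c.compat i j hi (fun hh => hj0 hh.2), ← c'.compat i j hi (fun hh => hj0 hh.2)]
    exact hI i

theorem IsCN.root_child {n : ℕ} [NeZero n] (hn : 2 ≤ n) {d : Fin n → Fin n → Bool} (h : IsCN d) :
    ∃ i : Fin n, 0 < i ∧ d i 0 = true := by
  have h1 : (⟨1, hn⟩ : Fin n) ≠ 0 := by
    intro hh; simpa using congrArg Fin.val hh
  obtain ⟨j, hj, hm, i', hi', hd'⟩ := h.first_row _ h1
  have hi0 : i' = 0 := by
    apply Fin.ext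
    have : (i' : ℕ) < 1 := hi'
    rw [Fin.val_zero]; omega
  subst hi0
  by_cases hj0 : j = 0
  · subst hj0; exact ⟨_, hi', hj⟩
  · exact (h.complete 0 0 h.root).2 ⟨j, cn_pos hj0, hd'⟩

theorem IsCN.card_le {n : ℕ} [NeZero n] (hn : 2 ≤ n) {d : Fin n → Fin n → Bool} (h : IsCN d)
    {I J : Finset (Fin n)} (c : ∀ i j, d i j = true → ¬(i = 0 ∧ j = 0) → (i ∈ I ↔ j ∈ J)) :
    I.card ≤ J.card := by
  choose g hg hm using fun i => cn_exists_last (fun j => d i j = true) (h.min_row i)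
  refine Finset.card_le_card_of_injOn g ?_ ?_
  · intro i hi
    refine (c i (g i) (hg i) ?_).1 hi
    rintro ⟨rfl, h0⟩
    obtain ⟨j, hj, hd⟩ := h.swap.root_child hn
    exact hm 0 j (h0.symm ▸ hj : g 0 < j) hd
  · have key : ∀ a b, a < b → g a ≠ g b := by
      intro a b hab he
      obtain ⟨j, hj, hd⟩ := (h.complete a (g a) (hg a)).1 ⟨b, hab, he ▸ hg b⟩
      exact hm a j hj hd
    intro a _ b _ he
    rcases lt_trichotomy a b with q | q | q
    · exact absurd he (key a b q)
    · exact q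
    · exact absurd he.symm (key b a q)

theorem IsCN.card_eq {n : ℕ} [NeZero n] (hn : 2 ≤ n) {d : Fin n → Fin n → Bool} (h : IsCN d)
    {I J : Finset (Fin n)} (c : Compat d I J) : I.card = J.card :=
  le_antisymm (h.card_le hn c.compat)
    (h.swap.card_le hn fun i j hd hh => (c.compat j i hd fun hx => hh hx.symm).symm)

/-- The block data. -/
structure Blk {n k l : ℕ} [NeZero n] [NeZero k] [NeZero l] (e f : Fin k ⊕ Fin l ≃ Fin n) : Prop where
  el : ∀ a b, e (Sum.inl a) < e (Sum.inl b) ↔ a < b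
  er : ∀ a b, e (Sum.inr a) < e (Sum.inr b) ↔ a < b
  fl : ∀ a b, f (Sum.inl a) < f (Sum.inl b) ↔ a < b
  fr : ∀ a b, f (Sum.inr a) < f (Sum.inr b) ↔ a < b
  e0 : e (Sum.inr 0) = 0
  f0 : f (Sum.inl 0) = 0

section blk
set_option linter.unusedSectionVars false
variable {n k l : ℕ} [NeZero n] [NeZero k] [NeZero l] {e f : Fin k ⊕ Fin l ≃ Fin n}
  {d : Fin n → Fin n → Bool}

theorem Blk.swap (B : Blk e f) : Blk ((Equiv.sumComm _ _).trans f) ((Equiv.sumComm _ _).trans e) where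
  el := by simpa using B.fr
  er := by simpa using B.fl
  fl := by simpa using B.er
  fr := by simpa using B.el
  e0 := by simpa using B.f0
  f0 := by simpa using B.e0

theorem Blk.pos (B : Blk e f) (a : Fin k) : 0 < e (Sum.inl a) := by
  apply cn_pos
  rw [← B.e0]
  intro h
  simpa using e.injective h

theorem Blk.ex (e : Fin k ⊕ Fin l ≃ Fin n) (P : Fin n → Prop) :
    (∃ i, P i) ↔ (∃ a, P (e (Sum.inl a))) ∨ (∃ a, P (e (Sum.inr a))) := by
  rw [← e.exists_congr_right (q := P), Sum.exists]

theorem Blk.above (B : Blk e f)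
    (h21 : ∀ a b, d (e (Sum.inr a)) (f (Sum.inl b)) = true ↔ a = 0 ∧ b = 0) (a : Fin k) (b : Fin k) :
    (∃ i' : Fin n, i' < e (Sum.inl a) ∧ d i' (f (Sum.inl b)) = true) ↔
      (∃ a' : Fin k, a' < a ∧ d (e (Sum.inl a')) (f (Sum.inl b)) = true) ∨ b = 0 := by
  rw [Blk.ex e]
  simp only [B.el, h21]
  refine or_congr Iff.rfl ⟨fun ⟨x, h1, h2⟩ => h2.2, fun h => ⟨0, ?_, rfl, h⟩⟩
  rw [B.e0]; exact B.pos a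

theorem Blk.below (B : Blk e f)
    (h21 : ∀ a b, d (e (Sum.inr a)) (f (Sum.inl b)) = true ↔ a = 0 ∧ b = 0) (a : Fin k) (b : Fin k) :
    (∃ i' : Fin n, e (Sum.inl a) < i' ∧ d i' (f (Sum.inl b)) = true) ↔
      (∃ a' : Fin k, a < a' ∧ d (e (Sum.inl a')) (f (Sum.inl b)) = true) := by
  rw [Blk.ex e]
  simp only [B.el, h21]
  refine or_iff_left ?_
  rintro ⟨x, h1, rfl, h2⟩
  rw [B.e0] at h1
  exact Fin.not_lt_zero _ h1

theorem Blk.left (B : Blk e f)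
    (h12 : ∀ a b, d (e (Sum.inl a)) (f (Sum.inr b)) = false) (a : Fin k) (b : Fin k) :
    (∃ j' : Fin n, j' < f (Sum.inl b) ∧ d (e (Sum.inl a)) j' = true) ↔
      (∃ b' : Fin k, b' < b ∧ d (e (Sum.inl a)) (f (Sum.inl b')) = true) := by
  rw [Blk.ex f]
  simp [B.fl, h12]

theorem Blk.right (B : Blk e f)
    (h12 : ∀ a b, d (e (Sum.inl a)) (f (Sum.inr b)) = false) (a : Fin k) (b : Fin k) :
    (∃ j' : Fin n, f (Sum.inl b) < j' ∧ d (e (Sum.inl a)) j' = true) ↔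
      (∃ b' : Fin k, b < b' ∧ d (e (Sum.inl a)) (f (Sum.inl b')) = true) := by
  rw [Blk.ex f]
  simp [B.fl, h12]

theorem Blk.toL (B : Blk e f)
    (h12 : ∀ a b, d (e (Sum.inl a)) (f (Sum.inr b)) = false)
    (h21 : ∀ a b, d (e (Sum.inr a)) (f (Sum.inl b)) = true ↔ a = 0 ∧ b = 0) (h : IsCN d) :
    IsCN (fun a b => d (e (Sum.inl a)) (f (Sum.inl b))) := by
  have hroot : d (e (Sum.inl 0)) (f (Sum.inl 0)) = true := by
    obtain ⟨j, hj, hm, hi'⟩ := h.first_row (e (Sum.inl 0)) (B.pos 0).ne'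
    obtain ⟨j, rfl⟩ := f.surjective j
    rcases j with j | j
    · rw [B.above h21] at hi'
      rcases hi' with ⟨a, h1, _⟩ | rfl
      · exact absurd h1 (Fin.not_lt_zero _)
      · exact hj
    · simp [h12] at hj
  refine ⟨hroot, ?_, ?_, ?_, ?_⟩
  · intro a b hd hn
    have := h.nonamb _ _ hd (fun hh => (B.pos a).ne' hh.1)
    rw [B.above h21, B.left h12] at this
    convert this using 1
    refine (or_iff_left_of_imp ?_).symm
    rintro rfl
    exact ⟨0, cn_pos (fun ha => hn ⟨ha, rfl⟩), hroot⟩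
  · intro a
    have := h.min_row (e (Sum.inl a))
    rw [Blk.ex f] at this
    simpa [h12] using this
  · intro b
    have := h.min_col (f (Sum.inl b))
    rw [Blk.ex e] at this
    rcases this with h1 | ⟨a, h1⟩
    · exact h1
    · rw [h21] at h1
      rw [h1.2]
      exact ⟨0, hroot⟩
  · intro a b hd
    rw [← B.below h21, ← B.right h12]
    exact h.complete _ _ hd

/-- The local conditions for the left block. -/
theorem Blk.ofL (B : Blk e f)
    (h12 : ∀ a b, d (e (Sum.inl a)) (f (Sum.inr b)) = false)
    (h21 : ∀ a b, d (e (Sum.inr a)) (f (Sum.inl b)) = true ↔ a = 0 ∧ b = 0)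
    (h : IsCN (fun a b => d (e (Sum.inl a)) (f (Sum.inl b)))) (a b : Fin k)
    (hd : d (e (Sum.inl a)) (f (Sum.inl b)) = true) :
    Xor' (∃ i' : Fin n, i' < e (Sum.inl a) ∧ d i' (f (Sum.inl b)) = true)
         (∃ j' : Fin n, j' < f (Sum.inl b) ∧ d (e (Sum.inl a)) j' = true) ∧
    ((∃ i' : Fin n, e (Sum.inl a) < i' ∧ d i' (f (Sum.inl b)) = true) ↔
      (∃ j' : Fin n, f (Sum.inl b) < j' ∧ d (e (Sum.inl a)) j' = true)) := by
  rw [B.above h21, B.left h12, B.below h21, B.right h12]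
  refine ⟨?_, h.complete a b hd⟩
  by_cases hn : a = 0 ∧ b = 0
  · left
    refine ⟨Or.inr hn.2, ?_⟩
    rintro ⟨b', hb, _⟩
    rw [hn.2] at hb
    exact Fin.not_lt_zero _ hb
  · convert h.nonamb a b hd hn using 1
    refine or_iff_left_of_imp ?_
    rintro rfl
    exact ⟨0, cn_pos (fun ha => hn ⟨ha, rfl⟩), h.root⟩

theorem Blk.toR (B : Blk e f)
    (h12 : ∀ a b, d (e (Sum.inl a)) (f (Sum.inr b)) = false)
    (h21 : ∀ a b, d (e (Sum.inr a)) (f (Sum.inl b)) = true ↔ a = 0 ∧ b = 0) (h : IsCN d) :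
    IsCN (fun a b => d (e (Sum.inr a)) (f (Sum.inr b))) :=
  (B.swap.toL (d := fun i j => d j i) (fun a b => by simpa using h12 b a)
    (fun a b => by simpa [and_comm] using h21 b a) h.swap).swap

theorem Blk.ofR (B : Blk e f)
    (h12 : ∀ a b, d (e (Sum.inl a)) (f (Sum.inr b)) = false)
    (h21 : ∀ a b, d (e (Sum.inr a)) (f (Sum.inl b)) = true ↔ a = 0 ∧ b = 0)
    (h : IsCN (fun a b => d (e (Sum.inr a)) (f (Sum.inr b)))) (a b : Fin l)
    (hd : d (e (Sum.inr a)) (f (Sum.inr b)) = true) :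
    Xor' (∃ i' : Fin n, i' < e (Sum.inr a) ∧ d i' (f (Sum.inr b)) = true)
         (∃ j' : Fin n, j' < f (Sum.inr b) ∧ d (e (Sum.inr a)) j' = true) ∧
    ((∃ i' : Fin n, e (Sum.inr a) < i' ∧ d i' (f (Sum.inr b)) = true) ↔
      (∃ j' : Fin n, f (Sum.inr b) < j' ∧ d (e (Sum.inr a)) j' = true)) := by
  have := B.swap.ofL (d := fun i j => d j i) (fun a b => by simpa using h12 b a)
    (fun a b => by simpa [and_comm] using h21 b a) h.swap b a hd
  exact ⟨this.1.symm, this.2.symm⟩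

theorem Blk.iff (B : Blk e f)
    (h12 : ∀ a b, d (e (Sum.inl a)) (f (Sum.inr b)) = false)
    (h21 : ∀ a b, d (e (Sum.inr a)) (f (Sum.inl b)) = true ↔ a = 0 ∧ b = 0) :
    IsCN d ↔ IsCN (fun a b => d (e (Sum.inl a)) (f (Sum.inl b))) ∧
      IsCN (fun a b => d (e (Sum.inr a)) (f (Sum.inr b))) := by
  refine ⟨fun h => ⟨B.toL h12 h21 h, B.toR h12 h21 h⟩, fun ⟨hL, hR⟩ => ⟨?_, ?_, ?_, ?_, ?_⟩⟩
  · have := (h21 0 0).2 ⟨rfl, rfl⟩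
    rwa [B.e0, B.f0] at this
  · intro i j hd hn
    obtain ⟨x, rfl⟩ := e.surjective i
    obtain ⟨y, rfl⟩ := f.surjective j
    rcases x with a | a <;> rcases y with b | b
    · exact (B.ofL h12 h21 hL a b hd).1
    · simp [h12] at hd
    · rw [h21] at hd
      refine absurd ⟨?_, ?_⟩ hn
      · rw [hd.1, B.e0]
      · rw [hd.2, B.f0]
    · exact (B.ofR h12 h21 hR a b hd).1
  · intro i
    obtain ⟨x, rfl⟩ := e.surjective i
    rcases x with a | a
    · obtain ⟨b, hb⟩ := hL.min_row a
      exact ⟨_, hb⟩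
    · obtain ⟨b, hb⟩ := hR.min_row a
      exact ⟨_, hb⟩
  · intro i
    obtain ⟨x, rfl⟩ := f.surjective i
    rcases x with a | a
    · obtain ⟨b, hb⟩ := hL.min_col a
      exact ⟨_, hb⟩
    · obtain ⟨b, hb⟩ := hR.min_col a
      exact ⟨_, hb⟩
  · intro i j hd
    obtain ⟨x, rfl⟩ := e.surjective i
    obtain ⟨y, rfl⟩ := f.surjective j
    rcases x with a | a <;> rcases y with b | b
    · exact (B.ofL h12 h21 hL a b hd).2
    · simp [h12] at hd
    · rw [h21] at hd
      obtain ⟨rfl, rfl⟩ := hd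
      refine iff_of_true ⟨e (Sum.inl 0), ?_, hL.root⟩ ⟨f (Sum.inr 0), ?_, hR.root⟩
      · rw [B.e0]; exact B.pos 0
      · rw [B.f0]; exact B.swap.pos 0
    · exact (B.ofR h12 h21 hR a b hd).2
end blk

noncomputable def dt {n : ℕ} (d : Fin n → Fin n → Bool) : ℤ :=
  Matrix.det (Matrix.of fun i j => if d i j then (1 : ℤ) else 0)

open scoped Classical in
noncomputable def cntS (n : ℕ) [NeZero n] (s : ℤ) : Finset (Fin n → Fin n → Bool) :=
  Finset.univ.filter fun d => IsCN d ∧ dt d = s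

theorem cn_zero {n : ℕ} [NeZero n] : (⟨0, NeZero.pos n⟩ : Fin n) = 0 := rfl

theorem cn_val_zero {n : ℕ} [NeZero n] (i : Fin n) : (i : ℕ) = 0 ↔ i = 0 := by
  constructor
  · intro h; apply Fin.ext; simpa using h
  · rintro rfl; simp

theorem CNAT.isCN {n : ℕ} [NeZero n] (M : CNAT n) : IsCN M.dot where
  root := M.root (NeZero.pos n)
  nonamb i j hd hn := M.nonambiguous i j hd (by simpa only [cn_val_zero] using hn)
  min_row := M.min_row
  min_col := M.min_col
  complete := M.complete

def IsCN.toCNAT {n : ℕ} [NeZero n] {d : Fin n → Fin n → Bool} (h : IsCN d) : CNAT n where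
  dot := d
  root _ := h.root
  nonambiguous i j hd hn := h.nonamb i j hd (by simpa only [cn_val_zero] using hn)
  min_row := h.min_row
  min_col := h.min_col
  complete := h.complete

theorem cn_count (n : ℕ) [NeZero n] (s : ℤ) :
    Nat.card {M : CNAT n // cnatDet M = s} = (cntS n s).card := by
  classical
  have E : {M : CNAT n // cnatDet M = s} ≃ {d : Fin n → Fin n → Bool // IsCN d ∧ dt d = s} :=
    { toFun := fun M => ⟨M.1.dot, M.1.isCN, M.2⟩
      invFun := fun d => ⟨d.2.1.toCNAT, d.2.2⟩
      left_inv := fun M => rfl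
      right_inv := fun d => rfl }
  rw [Nat.card_congr E, Nat.card_eq_fintype_card, Fintype.card_subtype]
  rfl

/-- Glue two blocks. -/
def cnGlue {n k l : ℕ} [NeZero k] [NeZero l] (e f : Fin k ⊕ Fin l ≃ Fin n)
    (p : (Fin k → Fin k → Bool) × (Fin l → Fin l → Bool)) (i j : Fin n) : Bool :=
  match e.symm i, f.symm j with
  | Sum.inl a, Sum.inl b => p.1 a b
  | Sum.inr a, Sum.inr b => p.2 a b
  | Sum.inr a, Sum.inl b => decide (a = 0 ∧ b = 0)
  | Sum.inl _, Sum.inr _ => false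

open Finset in
open scoped Classical in
theorem cn_fiber (k l : ℕ) [NeZero k] [NeZero l] [NeZero (k + l)] (I J : Finset (Fin (k + l)))
    (hI : I.card = k) (hJ : J.card = k) (zI : 0 ∉ I) (zJ : 0 ∈ J) (s : ℤ) :
    #{d : Fin (k + l) → Fin (k + l) → Bool | (IsCN d ∧ dt d = s) ∧ Compat d I J} =
    #{p : (Fin k → Fin k → Bool) × (Fin l → Fin l → Bool) |
      IsCN p.1 ∧ IsCN p.2 ∧ (-1) ^ (∑ i ∈ I, (i : ℕ) + ∑ j ∈ J, (j : ℕ)) * (dt p.1 * dt p.2) = s} := by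
  have hIc : #Iᶜ = l := by rw [card_compl, hI, Fintype.card_fin]; omega
  have hJc : #Jᶜ = l := by rw [card_compl, hJ, Fintype.card_fin]; omega
  obtain ⟨e, he⟩ : ∃ e, e = finSumEquivOfFinset hI hIc := ⟨_, rfl⟩
  obtain ⟨f, hf⟩ : ∃ f, f = finSumEquivOfFinset hJ hJc := ⟨_, rfl⟩
  have eI : ∀ a, e (Sum.inl a) ∈ I := fun a => by
    rw [he, finSumEquivOfFinset_inl]; exact orderEmbOfFin_mem _ _ _
  have eIc : ∀ a, e (Sum.inr a) ∉ I := fun a => by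
    rw [he, finSumEquivOfFinset_inr, ← mem_compl]; exact orderEmbOfFin_mem _ _ _
  have fJ : ∀ a, f (Sum.inl a) ∈ J := fun a => by
    rw [hf, finSumEquivOfFinset_inl]; exact orderEmbOfFin_mem _ _ _
  have fJc : ∀ a, f (Sum.inr a) ∉ J := fun a => by
    rw [hf, finSumEquivOfFinset_inr, ← mem_compl]; exact orderEmbOfFin_mem _ _ _
  have el : ∀ a b, e (Sum.inl a) < e (Sum.inl b) ↔ a < b := fun a b => by simp [he]
  have er : ∀ a b, e (Sum.inr a) < e (Sum.inr b) ↔ a < b := fun a b => by simp [he]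
  have fl : ∀ a b, f (Sum.inl a) < f (Sum.inl b) ↔ a < b := fun a b => by simp [hf]
  have fr : ∀ a b, f (Sum.inr a) < f (Sum.inr b) ↔ a < b := fun a b => by simp [hf]
  have sI : ∑ a : Fin k, (e (Sum.inl a) : ℕ) = ∑ i ∈ I, (i : ℕ) := by
    conv_rhs => rw [← map_orderEmbOfFin_univ I hI, sum_map]
    simp [he]
  have sJ : ∑ a : Fin k, (f (Sum.inl a) : ℕ) = ∑ i ∈ J, (i : ℕ) := by
    conv_rhs => rw [← map_orderEmbOfFin_univ J hJ, sum_map]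
    simp [hf]
  have e0 : e (Sum.inr 0) = 0 := by
    obtain ⟨x, hx⟩ := e.surjective 0
    rcases x with a | a
    · exact absurd (hx ▸ eI a) zI
    · by_contra hne
      have := cn_pos hne
      rw [← hx, er] at this
      exact Fin.not_lt_zero _ this
  have f0 : f (Sum.inl 0) = 0 := by
    obtain ⟨x, hx⟩ := f.surjective 0
    rcases x with a | a
    · by_contra hne
      have := cn_pos hne
      rw [← hx, fl] at this
      exact Fin.not_lt_zero _ this
    · exact absurd zJ (hx ▸ fJc a)
  have B : Blk e f := ⟨el, er, fl, fr, e0, f0⟩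
  have cI : ∀ d, IsCN d → Compat d I J →
      (∀ a b, d (e (Sum.inl a)) (f (Sum.inr b)) = false) ∧
      (∀ a b, d (e (Sum.inr a)) (f (Sum.inl b)) = true ↔ a = 0 ∧ b = 0) := by
    intro d h c
    constructor
    · intro a b
      by_contra hd
      rw [Bool.not_eq_false] at hd
      exact fJc b ((c.compat _ _ hd fun hh => (B.pos a).ne' hh.1).1 (eI a))
    · intro a b
      constructor
      · intro hd
        by_contra hn
        refine eIc a ((c.compat _ _ hd fun hh => hn ⟨?_, ?_⟩).2 (fJ b))
        · have := e.injective (hh.1.trans e0.symm)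
          simpa using this
        · have := f.injective (hh.2.trans f0.symm)
          simpa using this
      · rintro ⟨rfl, rfl⟩
        rw [e0, f0]; exact h.root
  have hdt : ∀ d : Fin (k + l) → Fin (k + l) → Bool,
      (∀ a b, d (e (Sum.inl a)) (f (Sum.inr b)) = false) →
      dt d = (-1) ^ (∑ i ∈ I, (i : ℕ) + ∑ j ∈ J, (j : ℕ)) *
        (dt (fun a b => d (e (Sum.inl a)) (f (Sum.inl b))) *
         dt (fun a b => d (e (Sum.inr a)) (f (Sum.inr b)))) := by
    intro d h12
    rw [dt, cn_det e f el er fl fr _ (fun a b => by simp [h12]), sI, sJ, ← pow_add]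
    rfl
  have g11 : ∀ p a b, cnGlue e f p (e (Sum.inl a)) (f (Sum.inl b)) = p.1 a b := by
    intro p a b; simp [cnGlue]
  have g22 : ∀ p a b, cnGlue e f p (e (Sum.inr a)) (f (Sum.inr b)) = p.2 a b := by
    intro p a b; simp [cnGlue]
  have g12 : ∀ p a b, cnGlue e f p (e (Sum.inl a)) (f (Sum.inr b)) = false := by
    intro p a b; simp [cnGlue]
  have g21 : ∀ p a b, cnGlue e f p (e (Sum.inr a)) (f (Sum.inl b)) = true ↔ a = 0 ∧ b = 0 := by
    intro p a b; simp [cnGlue]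
  refine card_bij'
    (fun d _ => (fun a b => d (e (Sum.inl a)) (f (Sum.inl b)),
      fun a b => d (e (Sum.inr a)) (f (Sum.inr b)))) (fun p _ => cnGlue e f p) ?_ ?_ ?_ ?_
  · intro d hd
    simp only [mem_filter, mem_univ, true_and] at hd ⊢
    obtain ⟨⟨h1, h2⟩, h3⟩ := hd
    obtain ⟨h12, h21⟩ := cI d h1 h3
    obtain ⟨q1, q2⟩ := (B.iff h12 h21).1 h1
    exact ⟨q1, q2, by rw [← h2, hdt d h12]⟩
  · intro p hp
    simp only [mem_filter, mem_univ, true_and] at hp ⊢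
    refine ⟨⟨(B.iff (g12 p) (g21 p)).2 ?_, ?_⟩, zI, zJ, ?_⟩
    · simp only [g11, g22]; exact ⟨hp.1, hp.2.1⟩
    · rw [hdt _ (g12 p)]; simp only [g11, g22]; exact hp.2.2
    · intro i j hd hn
      obtain ⟨x, rfl⟩ := e.surjective i
      obtain ⟨y, rfl⟩ := f.surjective j
      rcases x with a | a <;> rcases y with b | b
      · exact iff_of_true (eI a) (fJ b)
      · simp [g12] at hd
      · rw [g21] at hd
        exact absurd ⟨by rw [hd.1, e0], by rw [hd.2, f0]⟩ hn
      · exact iff_of_false (eIc a) (fJc b)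
  · intro d hd
    simp only [mem_filter, mem_univ, true_and] at hd
    obtain ⟨⟨h1, h2⟩, h3⟩ := hd
    obtain ⟨h12, h21⟩ := cI d h1 h3
    funext i j
    obtain ⟨x, rfl⟩ := e.surjective i
    obtain ⟨y, rfl⟩ := f.surjective j
    rcases x with a | a <;> rcases y with b | b
    · rw [g11]
    · rw [g12, h12]
    · rw [Bool.eq_iff_iff, g21, h21]
    · rw [g22]
  · intro p hp
    simp only [g11, g22]

open Finset in
open scoped Classical in
theorem cn_pairs (k l : ℕ) [NeZero k] [NeZero l] (m : ℕ) :
    #{p : (Fin k → Fin k → Bool) × (Fin l → Fin l → Bool) |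
      IsCN p.1 ∧ IsCN p.2 ∧ (-1) ^ m * (dt p.1 * dt p.2) = 1} =
    if Even m then cnatA k * cnatA l + cnatB k * cnatB l
    else cnatA k * cnatB l + cnatB k * cnatA l := by
  simp only [cnatA, cnatB, cn_count]
  have hd : ∀ s t : ℤ, Disjoint (cntS k 1 ×ˢ cntS l s) (cntS k (-1) ×ˢ cntS l t) := by
    intro s t
    rw [disjoint_left]
    intro p h1 h2
    simp only [cntS, mem_product, mem_filter] at h1 h2
    have h1' := h1.1.2.2
    have h2' := h2.1.2.2
    omega
  split_ifs with hm
  · rw [← card_product, ← card_product, ← card_union_of_disjoint (hd _ _)]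
    congr 1
    ext p
    simp only [cntS, mem_union, mem_product, mem_filter, mem_univ, true_and, hm.neg_one_pow,
      one_mul, Int.mul_eq_one_iff_eq_one_or_neg_one]
    tauto
  · rw [← card_product, ← card_product, ← card_union_of_disjoint (hd _ _)]
    congr 1
    ext p
    have : (-1 : ℤ) ^ m * (dt p.1 * dt p.2) = 1 ↔ dt p.1 * dt p.2 = -1 := by
      rw [(Nat.not_even_iff_odd.1 hm).neg_one_pow]; omega
    simp only [cntS, mem_union, mem_product, mem_filter, mem_univ, true_and, this,
      Int.mul_eq_neg_one_iff_eq_one_or_neg_one]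
    tauto

open Finset in
theorem cn_subI (n : ℕ) [NeZero n] (k : ℕ) (P : ℕ → Prop) [DecidablePred P] :
    #{I : Finset (Fin n) | (0 ∉ I ∧ #I = k) ∧ P (∑ i ∈ I, (i : ℕ))} =
    #{S ∈ powersetCard k (Icc 1 (n - 1)) | P (S.sum id)} := by
  refine card_bij' (fun I _ => I.map Fin.valEmbedding)
    (fun S _ => univ.filter fun i : Fin n => (i : ℕ) ∈ S) ?_ ?_ ?_ ?_
  · intro I hI
    simp only [mem_filter, mem_univ, true_and] at hI
    simp only [mem_filter, mem_powersetCard, card_map, sum_map]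
    refine ⟨⟨?_, hI.1.2⟩, hI.2⟩
    intro x hx
    rw [mem_map] at hx
    obtain ⟨i, hi, rfl⟩ := hx
    have : (i : ℕ) ≠ 0 := by
      rw [Ne, cn_val_zero]; rintro rfl; exact hI.1.1 hi
    rw [mem_Icc]
    have := i.2
    simp only [Fin.valEmbedding_apply]
    omega
  · intro S hS
    simp only [mem_filter, mem_powersetCard] at hS
    have hmap : (univ.filter fun i : Fin n => (i : ℕ) ∈ S).map Fin.valEmbedding = S := by
      ext x
      simp only [mem_map, mem_filter, mem_univ, true_and, Fin.valEmbedding_apply]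
      constructor
      · rintro ⟨i, h, rfl⟩; exact h
      · intro h
        have := mem_Icc.1 (hS.1.1 h)
        exact ⟨⟨x, by omega⟩, h, rfl⟩
    simp only [mem_filter, mem_univ, true_and]
    refine ⟨⟨?_, ?_⟩, ?_⟩
    · intro h
      have := mem_Icc.1 (hS.1.1 h)
      simp at this
    · rw [← card_map Fin.valEmbedding, hmap, hS.1.2]
    · have h2 := hS.2
      rw [← hmap, sum_map] at h2
      exact h2
  · intro I hI
    ext x
    simp [Fin.val_inj]
  · intro S hS
    simp only [mem_filter, mem_powersetCard] at hS
    ext x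
    simp only [mem_map, mem_filter, mem_univ, true_and, Fin.valEmbedding_apply]
    constructor
    · rintro ⟨i, h, rfl⟩; exact h
    · intro h
      have := mem_Icc.1 (hS.1.1 h)
      exact ⟨⟨x, by omega⟩, h, rfl⟩

open Finset in
theorem cn_subJ (n : ℕ) [NeZero n] (k : ℕ) (hk : 1 ≤ k) (P : ℕ → Prop) [DecidablePred P] :
    #{I : Finset (Fin n) | (0 ∈ I ∧ #I = k) ∧ P (∑ i ∈ I, (i : ℕ))} =
    #{S ∈ powersetCard (k - 1) (Icc 1 (n - 1)) | P (S.sum id)} := by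
  rw [← cn_subI]
  refine card_bij' (fun I _ => I.erase 0) (fun I _ => insert 0 I) ?_ ?_ ?_ ?_
  · intro I hI
    simp only [mem_filter, mem_univ, true_and] at hI ⊢
    refine ⟨⟨notMem_erase _ _, by rw [card_erase_of_mem hI.1.1, hI.1.2]⟩, ?_⟩
    have := add_sum_erase I (fun i : Fin n => (i : ℕ)) hI.1.1
    simp only [Fin.val_zero, zero_add] at this
    rw [this]; exact hI.2
  · intro I hI
    simp only [mem_filter, mem_univ, true_and] at hI ⊢
    refine ⟨⟨mem_insert_self _ _, by rw [card_insert_of_notMem hI.1.1, hI.1.2]; omega⟩, ?_⟩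
    rw [sum_insert hI.1.1]
    simpa using hI.2
  · intro I hI
    simp only [mem_filter, mem_univ, true_and] at hI
    exact insert_erase hI.1.1
  · intro I hI
    simp only [mem_filter, mem_univ, true_and] at hI
    exact erase_insert hI.1.1

open Finset in
theorem cn_sum_parity {α β : Type*} (S : Finset α) (T : Finset β) (u : α → ℕ) (v : β → ℕ) (X Y : ℕ) :
    ∑ p ∈ S ×ˢ T, (if Even (u p.1 + v p.2) then X else Y) =
      X * (#{a ∈ S | Even (u a)} * #{b ∈ T | Even (v b)} +
        #{a ∈ S | Odd (u a)} * #{b ∈ T | Odd (v b)}) +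
      Y * (#{a ∈ S | Even (u a)} * #{b ∈ T | Odd (v b)} +
        #{a ∈ S | Odd (u a)} * #{b ∈ T | Even (v b)}) := by
  rw [sum_product]
  have h1 : ∀ a, ∑ b ∈ T, (if Even (u a + v b) then X else Y) =
      if Even (u a) then X * #{b ∈ T | Even (v b)} + Y * #{b ∈ T | Odd (v b)}
      else X * #{b ∈ T | Odd (v b)} + Y * #{b ∈ T | Even (v b)} := by
    intro a
    split_ifs with h
    · simp only [Nat.even_add, h, true_iff, sum_ite, sum_const, smul_eq_mul, Nat.not_even_iff_odd]
      ring
    · simp only [Nat.even_add, h, false_iff, sum_ite, sum_const, smul_eq_mul, Nat.not_even_iff_odd,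
        Nat.not_odd_iff_even]
      ring
  simp only [h1, sum_ite, sum_const, smul_eq_mul, Nat.not_even_iff_odd]
  ring

theorem cnat_A_recurrence (n : ℕ) (hn : 2 ≤ n) :
    cnatA n = ∑ k ∈ Finset.Icc 1 (n - 1),
      ((cnatA k * cnatA (n - k) + cnatB k * cnatB (n - k)) *
          (eCount (n - 1) (k - 1) * eCount (n - 1) k +
            oCount (n - 1) (k - 1) * oCount (n - 1) k) +
        (cnatA k * cnatB (n - k) + cnatB k * cnatA (n - k)) *
          (eCount (n - 1) (k - 1) * oCount (n - 1) k +
            oCount (n - 1) (k - 1) * eCount (n - 1) k)) := by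
  classical
  have : NeZero n := ⟨by omega⟩
  have hcol : ∀ d : Fin n → Fin n → Bool, ∃ p : Finset (Fin n) × Finset (Fin n),
      IsCN d → Compat d p.1 p.2 := by
    intro d
    by_cases h : IsCN d
    · obtain ⟨I, J, c⟩ := h.exists_compat
      exact ⟨(I, J), fun _ => c⟩
    · exact ⟨(∅, ∅), fun h' => absurd h' h⟩
  choose φ hφ using hcol
  have h1 : cnatA n = (cntS n 1).card := cn_count n 1
  rw [h1]
  let S : Finset (Finset (Fin n) × Finset (Fin n)) :=
    Finset.univ.filter fun p => 0 ∉ p.1 ∧ 0 ∈ p.2 ∧ p.1.card = p.2.card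
  rw [Finset.card_eq_sum_card_fiberwise (f := φ) (t := S)]
  swap
  · intro d hd
    have hd' : IsCN d := by
      simp only [cntS, Finset.coe_filter, Finset.mem_univ, true_and, Set.mem_ofPred_eq] at hd
      exact hd.1
    have c := hφ d hd'
    simp only [S, Finset.coe_filter, Finset.mem_univ, true_and, Set.mem_ofPred_eq]
    exact ⟨c.zI, c.zJ, hd'.card_eq hn c⟩
  rw [← Finset.sum_fiberwise_of_maps_to (s := S) (t := Finset.Icc 1 (n - 1))
    (g := fun p => p.1.card)]
  swap
  · intro p hp
    simp only [S, Finset.mem_filter, Finset.mem_univ, true_and] at hp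
    rw [Finset.mem_Icc]
    constructor
    · rw [hp.2.2]; exact Finset.card_pos.2 ⟨0, hp.2.1⟩
    · have := Finset.card_lt_univ_of_notMem hp.1
      rw [Fintype.card_fin] at this
      omega
  refine Finset.sum_congr rfl fun k hk => ?_
  rw [Finset.mem_Icc] at hk
  have hS : S.filter (fun p => p.1.card = k) =
      (Finset.univ.filter fun I : Finset (Fin n) => 0 ∉ I ∧ I.card = k) ×ˢ
      (Finset.univ.filter fun I : Finset (Fin n) => 0 ∈ I ∧ I.card = k) := by
    ext p
    simp only [S, Finset.mem_filter, Finset.mem_univ, true_and, Finset.mem_product]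
    constructor
    · rintro ⟨⟨a, b, c⟩, d⟩; exact ⟨⟨a, d⟩, b, by omega⟩
    · rintro ⟨⟨a, d⟩, b, c⟩; exact ⟨⟨a, b, by omega⟩, d⟩
  rw [hS]
  have hfib : ∀ p ∈ (Finset.univ.filter fun I : Finset (Fin n) => 0 ∉ I ∧ I.card = k) ×ˢ
      (Finset.univ.filter fun I : Finset (Fin n) => 0 ∈ I ∧ I.card = k),
      ((cntS n 1).filter fun d => φ d = p).card =
      if Even (∑ i ∈ p.1, (i : ℕ) + ∑ i ∈ p.2, (i : ℕ)) then
        cnatA k * cnatA (n - k) + cnatB k * cnatB (n - k)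
      else cnatA k * cnatB (n - k) + cnatB k * cnatA (n - k) := by
    rintro ⟨I, J⟩ hp
    simp only [Finset.mem_filter, Finset.mem_univ, true_and, Finset.mem_product] at hp
    have hf : ((cntS n 1).filter fun d => φ d = (I, J)) =
        Finset.univ.filter fun d => (IsCN d ∧ dt d = 1) ∧ Compat d I J := by
      ext d
      simp only [cntS, Finset.mem_filter, Finset.mem_univ, true_and]
      refine and_congr_right fun hd => ⟨fun h => ?_, fun h => ?_⟩
      · have := hφ d hd.1
        rw [h] at this
        exact this
      · obtain ⟨q1, q2⟩ := hd.1.compat_unique (hφ d hd.1) h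
        exact Prod.ext q1 q2
    rw [hf]
    obtain ⟨l, rfl⟩ : ∃ l, n = k + l := ⟨n - k, by omega⟩
    have : NeZero k := ⟨by omega⟩
    have : NeZero l := ⟨by omega⟩
    rw [cn_fiber k l I J hp.1.2 hp.2.2 hp.1.1 hp.2.1, cn_pairs, Nat.add_sub_cancel_left]
  rw [Finset.sum_congr rfl hfib,
    cn_sum_parity _ _ (fun I : Finset (Fin n) => ∑ i ∈ I, (i : ℕ)) (fun I : Finset (Fin n) => ∑ i ∈ I, (i : ℕ))]
  have w1 := cn_subI n k Even
  have w2 := cn_subI n k Odd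
  have w3 := cn_subJ n k hk.1 Even
  have w4 := cn_subJ n k hk.1 Odd
  have eE : ∀ m, (Finset.filter (fun S : Finset ℕ => Even (S.sum id))
      (Finset.powersetCard m (Finset.Icc 1 (n - 1)))).card = eCount (n - 1) m := by
    intro m; rw [eCount]
  have eO : ∀ m, (Finset.filter (fun S : Finset ℕ => Odd (S.sum id))
      (Finset.powersetCard m (Finset.Icc 1 (n - 1)))).card = oCount (n - 1) m := by
    intro m; rw [oCount]
  rw [eE] at w1 w3
  rw [eO] at w2 w4
  rw [← w1, ← w2, ← w3, ← w4]
  simp only [Finset.filter_filter]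
  ring
end

section
/- For all integers n ≥ 2, the defect D_n = A_n − B_n satisfies the recurrence D_n = Σ_{k=1}^{n-1} D_k·D_{n-k}·(e^{n-1}_{k-1} − o^{n-1}_{k-1})·(e^{n-1}_k − o^{n-1}_k). -/
def fsg {α : Type*} [LinearOrder α] (s t : α) : ℤˣ := if t < s then -1 else 1

theorem fsg_prod_univ {n : ℕ} (s : Fin n) : ∏ t : Fin n, fsg s t = (-1) ^ (s : ℕ) := by
  unfold fsg
  rw [Finset.prod_ite]
  simp only [Finset.prod_const, one_pow, mul_one]
  congr 1
  have : (Finset.univ.filter fun x => x < s) = Finset.Iio s := by ext; simp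
  rw [this, Fin.card_Iio]

theorem fsg_self {α : Type*} [LinearOrder α] (s t : α) : fsg s t * fsg s t = 1 := by
  unfold fsg; split_ifs <;> simp

theorem sgn_block {k l : ℕ} (S : Finset (Fin (k+l))) (hS : S.card = k) (hc : Sᶜ.card = l) :
    Equiv.Perm.sign ((finSumFinEquiv (m := k) (n := l)).symm.trans (finSumEquivOfFinset hS hc)) =
      (-1) ^ (∑ i ∈ S, (i : ℕ)) * ∏ a : Fin k, ∏ b : Fin k, fsg a b := by
  have h1 : Equiv.Perm.sign
      ((finSumFinEquiv (m := k) (n := l)).symm.trans (finSumEquivOfFinset hS hc)) =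
      ∏ a : Fin k, ∏ b : Fin l, fsg (S.orderEmbOfFin hS a) (Sᶜ.orderEmbOfFin hc b) := by
    rw [Equiv.Perm.sign_eq_prod_prod_Ioi, Fin.prod_univ_add]
    have e2 : ∀ b : Fin l, ∏ j ∈ Finset.Ioi (Fin.natAdd k b), (if
        ((finSumFinEquiv (m := k) (n := l)).symm.trans (finSumEquivOfFinset hS hc)) (Fin.natAdd k b)
        < ((finSumFinEquiv (m := k) (n := l)).symm.trans (finSumEquivOfFinset hS hc)) j
          then (1 : ℤˣ) else -1) = 1 := by
      intro b
      apply Finset.prod_eq_one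
      intro j hj
      rw [Finset.mem_Ioi] at hj
      induction j using Fin.addCases with
      | left i =>
        have h1 : k + (b : ℕ) < (i : ℕ) := hj
        omega
      | right i =>
        have : b < i := by
          have h1 : k + (b : ℕ) < k + (i : ℕ) := hj
          rw [Fin.lt_def]; omega
        simp [this]
    rw [Finset.prod_eq_one (fun b _ => e2 b), mul_one]
    refine Finset.prod_congr rfl fun a _ => ?_
    have : ∀ g : Fin (k+l) → ℤˣ, ∏ j ∈ Finset.Ioi (Fin.castAdd l a), g j =
        (∏ i : Fin k, if a < i then g (Fin.castAdd l i) else 1) * ∏ b : Fin l, g (Fin.natAdd k b) := by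
      intro g
      have : Finset.Ioi (Fin.castAdd l a) = Finset.univ.filter (fun j => Fin.castAdd l a < j) := by
        ext; simp
      rw [this, Finset.prod_filter, Fin.prod_univ_add]
      congr 1
      refine Finset.prod_congr rfl fun b _ => ?_
      rw [if_pos]
      simp [Fin.lt_def]; omega
    rw [this, Finset.prod_eq_one, one_mul]
    · refine Finset.prod_congr rfl fun b _ => ?_
      simp only [Equiv.trans_apply, finSumFinEquiv_symm_apply_castAdd,
        finSumFinEquiv_symm_apply_natAdd, finSumEquivOfFinset_inl, finSumEquivOfFinset_inr, fsg]
      have hne : S.orderEmbOfFin hS a ≠ Sᶜ.orderEmbOfFin hc b := by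
        intro h
        have h1 := S.orderEmbOfFin_mem hS a
        have h2 := Sᶜ.orderEmbOfFin_mem hc b
        rw [← h, Finset.mem_compl] at h2
        exact h2 h1
      rcases lt_or_gt_of_ne hne with h | h
      · rw [if_pos h, if_neg h.not_gt]
      · rw [if_neg h.not_gt, if_pos h]
    · intro i _
      split_ifs with h1 h2
      · rfl
      · simp [h1] at h2
      · rfl
  rw [h1]
  have h2 : ∀ g : Fin (k+l) → ℤˣ, ∏ b : Fin l, g (Sᶜ.orderEmbOfFin hc b) = ∏ t ∈ Sᶜ, g t := by
    intro g
    conv_rhs => rw [← Finset.map_orderEmbOfFin_univ Sᶜ hc, Finset.prod_map]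
    rfl
  have h3 : ∀ g : Fin (k+l) → ℤˣ, ∏ b : Fin k, g (S.orderEmbOfFin hS b) = ∏ t ∈ S, g t := by
    intro g
    conv_rhs => rw [← Finset.map_orderEmbOfFin_univ S hS, Finset.prod_map]
    rfl
  have h4 : ∀ s : Fin (k+l), ∏ t ∈ Sᶜ, fsg s t = (-1) ^ (s : ℕ) * ∏ t ∈ S, fsg s t := by
    intro s
    rw [← fsg_prod_univ, ← Finset.prod_compl_mul_prod S, mul_assoc, ← Finset.prod_mul_distrib]
    simp
  calc _ = ∏ a : Fin k, ∏ t ∈ Sᶜ, fsg (S.orderEmbOfFin hS a) t :=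
        Finset.prod_congr rfl fun a _ => h2 _
    _ = ∏ a : Fin k, ((-1) ^ (S.orderEmbOfFin hS a : ℕ) * ∏ t ∈ S, fsg (S.orderEmbOfFin hS a) t) :=
        Finset.prod_congr rfl fun a _ => h4 _
    _ = _ := by
        rw [Finset.prod_mul_distrib]
        congr 1
        · rw [h3 (fun s => (-1) ^ (s : ℕ)), Finset.prod_pow_eq_pow_sum]
        · refine Finset.prod_congr rfl fun a _ => ?_
          rw [← h3]
          refine Finset.prod_congr rfl fun b _ => ?_
          simp [fsg]

theorem det_block {k l : ℕ} (M : Matrix (Fin (k+l)) (Fin (k+l)) ℤ)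
    (S T : Finset (Fin (k+l))) (hS : S.card = k) (hSc : Sᶜ.card = l) (hT : T.card = k)
    (hTc : Tᶜ.card = l) (h0 : ∀ i ∈ S, ∀ j ∉ T, M i j = 0) :
    M.det = (-1) ^ (∑ i ∈ S, (i : ℕ)) * (-1) ^ (∑ i ∈ T, (i : ℕ)) *
      ((M.submatrix (S.orderEmbOfFin hS) (T.orderEmbOfFin hT)).det *
       (M.submatrix (Sᶜ.orderEmbOfFin hSc) (Tᶜ.orderEmbOfFin hTc)).det) := by
  set eS := finSumEquivOfFinset hS hSc with heS
  set eT := finSumEquivOfFinset hT hTc with heT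
  set f := (finSumFinEquiv (m := k) (n := l)).symm with hf
  have key : (M.submatrix eS eT).det = (M.submatrix (S.orderEmbOfFin hS) (T.orderEmbOfFin hT)).det *
       (M.submatrix (Sᶜ.orderEmbOfFin hSc) (Tᶜ.orderEmbOfFin hTc)).det := by
    rw [← Matrix.det_fromBlocks_zero₁₂ _
      (M.submatrix (Sᶜ.orderEmbOfFin hSc) (T.orderEmbOfFin hT)) _]
    congr 1
    ext i j
    rcases i with i | i <;> rcases j with j | j <;> simp [heS, heT]
    apply h0 _ (S.orderEmbOfFin_mem hS i)
    exact Finset.mem_compl.1 (Tᶜ.orderEmbOfFin_mem hTc j)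
  rw [← key, ← Matrix.det_submatrix_equiv_self f]
  have : (M.submatrix eS eT).submatrix f f
      = (M.submatrix (f.trans eS : Equiv.Perm _) id).submatrix id (f.trans eT : Equiv.Perm _) := rfl
  rw [this, Matrix.det_permute', Matrix.det_permute, sgn_block, sgn_block]
  set c := ∏ a : Fin k, ∏ b : Fin k, fsg a b
  have hc : (c : ℤ) * c = 1 := by
    rcases Int.units_eq_one_or c with h | h <;> simp [h]
  have hs : ∀ a : ℕ, ((-1 : ℤ)) ^ a * (-1) ^ a = 1 := by
    intro a; rw [← mul_pow]; simp
  push_cast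
  have h1 := hs (∑ i ∈ S, (i : ℕ))
  have h2 := hs (∑ i ∈ T, (i : ℕ))
  generalize (-1 : ℤ) ^ (∑ i ∈ S, (i : ℕ)) = x at *
  generalize (-1 : ℤ) ^ (∑ i ∈ T, (i : ℕ)) = y at *
  linear_combination (-(y*y*(c:ℤ)*c*M.det)) * h1 - ((c:ℤ)*c*M.det) * h2 - M.det * hc

structure IsC {α β : Type} [LinearOrder α] [LinearOrder β] (d : α → β → Bool) : Prop where
  root : ∀ i j, IsBot i → IsBot j → d i j = true
  nonamb : ∀ i j, d i j = true → ¬ (IsBot i ∧ IsBot j) →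
    Xor (∃ i', i' < i ∧ d i' j = true) (∃ j', j' < j ∧ d i j' = true)
  row : ∀ i, ∃ j, d i j = true
  col : ∀ j, ∃ i, d i j = true
  compl : ∀ i j, d i j = true →
    ((∃ i', i < i' ∧ d i' j = true) ↔ (∃ j', j < j' ∧ d i j' = true))

section
variable {α β : Type} [LinearOrder α] [LinearOrder β]

theorem IsC.transpose {d : α → β → Bool} (h : IsC d) : IsC (fun j i => d i j) where
  root i j hi hj := h.root j i hj hi
  nonamb i j hd hn := (h.nonamb j i hd (fun x => hn ⟨x.2, x.1⟩)).symm
  row := h.col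
  col := h.row
  compl i j hd := (h.compl j i hd).symm

theorem IsC.congr {α' β' : Type} [LinearOrder α'] [LinearOrder β'] (e : α' ≃o α) (f : β' ≃o β)
    {d : α → β → Bool} : IsC (fun i j => d (e i) (f j)) ↔ IsC d := by
  have main : ∀ {α α' β β' : Type} [LinearOrder α] [LinearOrder β] [LinearOrder α'] [LinearOrder β']
    (e : α' ≃o α) (f : β' ≃o β) (d : α → β → Bool), IsC d → IsC (fun i j => d (e i) (f j)) := by
    intro α α' β β' _ _ _ _ e f d h
    have he : ∀ i, IsBot (e i) ↔ IsBot i := fun i =>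
      ⟨fun h j => e.le_iff_le.1 (h (e j)), fun h j => by
        rw [← e.apply_symm_apply j]; exact e.le_iff_le.2 (h _)⟩
    have hf : ∀ i, IsBot (f i) ↔ IsBot i := fun i =>
      ⟨fun h j => f.le_iff_le.1 (h (f j)), fun h j => by
        rw [← f.apply_symm_apply j]; exact f.le_iff_le.2 (h _)⟩
    have ee : ∀ P : α → Prop, (∃ i, P (e i)) ↔ ∃ i, P i := fun P => e.surjective.exists.symm
    have ff : ∀ P : β → Prop, (∃ i, P (f i)) ↔ ∃ i, P i := fun P => f.surjective.exists.symm
    refine ⟨?_, ?_, ?_, ?_, ?_⟩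
    · intro i j hi hj
      exact h.root _ _ ((he i).2 hi) ((hf j).2 hj)
    · intro i j hd hn
      have := h.nonamb _ _ hd (by rwa [he, hf])
      rw [← ee, ← ff] at this
      simpa using this
    · intro i; rw [ff (fun j => d (e i) j = true)]; exact h.row _
    · intro j; rw [ee (fun i => d i (f j) = true)]; exact h.col _
    · intro i j hd
      have := h.compl _ _ hd
      rw [← ee, ← ff] at this
      simpa using this
  refine ⟨fun h => ?_, main e f d⟩
  have := main e.symm f.symm _ h
  simpa using this

/-- compatibility of a colouring with a filling -/
def Compat_s2 (r0 : α) (c0 : β) (d : α → β → Bool) (S : Finset α) (T : Finset β) : Prop :=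
  ∀ i j, d i j = true → ¬ (i = r0 ∧ j = c0) → (i ∈ S ↔ j ∈ T)

theorem bot_iff {r0 : α} (h : IsBot r0) (i : α) : IsBot i ↔ i = r0 :=
  ⟨fun hi => le_antisymm (hi _) (h _), fun e => e ▸ h⟩

theorem IsC.exists_below [Finite α] [Finite β] [Nontrivial α] {r0 : α} {c0 : β} (hr : IsBot r0) (hc : IsBot c0)
    {d : α → β → Bool} (h : IsC d) : ∃ i, r0 < i ∧ d i c0 = true := by
  by_contra hno
  have hno2 : ¬ ∃ j, c0 < j ∧ d r0 j = true := by
    rwa [← h.compl _ _ (h.root _ _ hr hc)]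
  obtain ⟨r, hrr⟩ := exists_ne r0
  obtain ⟨m, hm, hmin⟩ := WellFounded.has_min (wellFounded_lt (α := α)) {x | x ≠ r0} ⟨r, hrr⟩
  have hm0 : r0 < m := lt_of_le_of_ne (hr m) (Ne.symm hm)
  have hall : ∀ c, d m c = true → ∃ c', c' < c ∧ d m c' = true := by
    intro c hc'
    have hcc : c ≠ c0 := fun e => hno ⟨m, hm0, e ▸ hc'⟩
    rcases h.nonamb m c hc' (fun x => hm ((bot_iff hr m).1 x.1)) with ⟨⟨i', hi', hd⟩, _⟩ | ⟨hl, _⟩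
    · have : i' = r0 := by
        by_contra hne
        exact hmin i' hne hi'
      subst this
      exact absurd ⟨c, lt_of_le_of_ne (hc c) (Ne.symm hcc), hd⟩ hno2
    · exact hl
  obtain ⟨c, hcm, hcmin⟩ :=
    WellFounded.has_min (wellFounded_lt (α := β)) {x | d m x = true} (h.row m)
  obtain ⟨c', h1, h2⟩ := hall c hcm
  exact hcmin c' h2 h1

theorem IsC.left [Finite α] [Finite β] [Nontrivial α] {r0 : α} {c0 : β} (hr : IsBot r0) (hc : IsBot c0)
    {d : α → β → Bool} {S : Finset α} {T : Finset β} (hS : r0 ∉ S) (hT : c0 ∈ T)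
    (hd : Compat_s2 r0 c0 d S T) (h : IsC d) : IsC (fun (i : S) (j : T) => d i j) := by
  obtain ⟨i1, hi1, hdi1⟩ := h.exists_below hr hc
  have hi1S : i1 ∈ S := (hd i1 c0 hdi1 (fun x => hi1.ne' x.1)).2 hT
  have hneS : ∀ i ∈ S, i ≠ r0 := fun i hi e => hS (e ▸ hi)
  have cS : ∀ i ∈ S, ∀ j, d i j = true → j ∈ T := fun i hi j hij =>
    (hd i j hij (fun x => hneS i hi x.1)).1 hi
  have cT : ∀ j ∈ T, ∀ i, d i j = true → i ≠ r0 ∨ j ≠ c0 → i ∈ S := fun j hj i hij hn =>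
    (hd i j hij (by tauto)).2 hj
  have hroot : ∀ m ∈ S, (∀ i ∈ S, m ≤ i) → d m c0 = true := by
    intro m hm hmin
    obtain ⟨c, hcm, hcmin⟩ := WellFounded.has_min (wellFounded_lt (α := β)) {x | d m x = true} (h.row m)
    by_cases hcc : c = c0
    · exact hcc ▸ hcm
    rcases h.nonamb m c hcm (fun x => hcc ((bot_iff hc c).1 x.2)) with ⟨⟨i', hi', hdi⟩, _⟩ | ⟨⟨j', hj', hdj⟩, _⟩
    · have := cT c (cS m hm c hcm) i' hdi (Or.inr hcc)
      exact absurd (hmin i' this) (not_le.2 hi')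
    · exact absurd hj' (hcmin j' hdj)
  obtain ⟨m, hmS, hmin⟩ := WellFounded.has_min (wellFounded_lt (α := α)) {x | x ∈ S} ⟨i1, hi1S⟩
  have hmin' : ∀ i ∈ S, m ≤ i := fun i hi => not_lt.1 (hmin i hi)
  have hmd := hroot m hmS hmin'
  refine ⟨?_, ?_, ?_, ?_, ?_⟩
  · rintro ⟨i, hi⟩ ⟨j, hj⟩ hbi hbj
    have : j = c0 := le_antisymm (hbj ⟨c0, hT⟩) (hc j)
    subst this
    exact hroot i hi fun i' hi' => hbi ⟨i', hi'⟩
  · rintro ⟨i, hi⟩ ⟨j, hj⟩ hij hnb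
    simp only at hij
    have hx := h.nonamb i j hij (fun x => hneS i hi ((bot_iff hr i).1 x.1))
    have e2 : (∃ j' : T, j' < ⟨j, hj⟩ ∧ d i j' = true) ↔ ∃ j', j' < j ∧ d i j' = true :=
      ⟨fun ⟨j', a, b⟩ => ⟨j', a, b⟩, fun ⟨j', a, b⟩ => ⟨⟨j', cS i hi _ b⟩, a, b⟩⟩
    have e1 : (∃ i' : S, i' < ⟨i, hi⟩ ∧ d i' j = true) ↔ ∃ i', i' < i ∧ d i' j = true := by
      refine ⟨fun ⟨j', a, b⟩ => ⟨j', a, b⟩, fun ⟨i', a, b⟩ => ?_⟩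
      by_cases hjc : j = c0
      · subst hjc
        refine ⟨⟨m, hmS⟩, ?_, hmd⟩
        refine lt_of_le_of_ne (hmin' i hi) fun e => hnb ⟨fun x => ?_, fun y => hc y⟩
        simp only [Subtype.mk.injEq] at e
        subst e
        exact hmin' _ x.2
      · exact ⟨⟨i', cT j hj _ b (Or.inr hjc)⟩, a, b⟩
    simp only [e1, e2]; exact hx
  · rintro ⟨i, hi⟩
    obtain ⟨j, hj⟩ := h.row i
    exact ⟨⟨j, cS i hi j hj⟩, hj⟩
  · rintro ⟨j, hj⟩
    by_cases hjc : j = c0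
    · subst hjc; exact ⟨⟨m, hmS⟩, hmd⟩
    · obtain ⟨i, hi⟩ := h.col j
      exact ⟨⟨i, cT j hj i hi (Or.inr hjc)⟩, hi⟩
  · rintro ⟨i, hi⟩ ⟨j, hj⟩ hij
    simp only at hij
    have hx := h.compl i j hij
    have e2 : (∃ j' : T, ⟨j, hj⟩ < j' ∧ d i j' = true) ↔ ∃ j', j < j' ∧ d i j' = true :=
      ⟨fun ⟨j', a, b⟩ => ⟨j', a, b⟩, fun ⟨j', a, b⟩ => ⟨⟨j', cS i hi _ b⟩, a, b⟩⟩
    have e1 : (∃ i' : S, ⟨i, hi⟩ < i' ∧ d i' j = true) ↔ ∃ i', i < i' ∧ d i' j = true :=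
      ⟨fun ⟨j', a, b⟩ => ⟨j', a, b⟩, fun ⟨i', a, b⟩ =>
        ⟨⟨i', cT j hj _ b (Or.inl ((hr i).trans_lt a).ne')⟩, a, b⟩⟩
    simp only [e1, e2]; exact hx

theorem Compat_s2.transpose [Fintype α] [Fintype β] {r0 : α} {c0 : β} {d : α → β → Bool} {S : Finset α} {T : Finset β}
    (hd : Compat_s2 r0 c0 d S T) : Compat_s2 c0 r0 (fun j i => d i j) Tᶜ Sᶜ := by
  intro j i hij hn
  have := hd i j hij (fun x => hn ⟨x.2, x.1⟩)
  simp only [Finset.mem_compl]; tauto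

theorem IsC.right [Fintype α] [Fintype β] [Nontrivial β] {r0 : α} {c0 : β} (hr : IsBot r0) (hc : IsBot c0)
    {d : α → β → Bool} {S : Finset α} {T : Finset β} (hS : r0 ∉ S) (hT : c0 ∈ T)
    (hd : Compat_s2 r0 c0 d S T) (h : IsC d) : 
    IsC (fun (i : (Sᶜ : Finset α)) (j : (Tᶜ : Finset β)) => d i j) :=
  (h.transpose.left hc hr (by simpa using hT) (by simpa using hS) hd.transpose).transpose

theorem IsC.combine [Fintype α] [Fintype β] {r0 : α} {c0 : β} (hr : IsBot r0) (hc : IsBot c0)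
    {d : α → β → Bool} {S : Finset α} {T : Finset β} (hS : r0 ∉ S) (hT : c0 ∈ T)
    (hd : Compat_s2 r0 c0 d S T) (h0 : d r0 c0 = true)
    (hL : IsC (fun (i : S) (j : T) => d i j)) 
    (hR : IsC (fun (i : (Sᶜ : Finset α)) (j : (Tᶜ : Finset β)) => d i j)) : IsC d := by
  have half : ∀ {α β : Type} [LinearOrder α] [LinearOrder β] [Fintype α] [Fintype β]
      {r0 : α} {c0 : β} (_ : IsBot r0) (_ : IsBot c0)
      {d : α → β → Bool} {S : Finset α} {T : Finset β} (_ : r0 ∉ S) (_ : c0 ∈ T)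
      (_ : Compat_s2 r0 c0 d S T) (_ : d r0 c0 = true) (_ : IsC (fun (i : S) (j : T) => d i j)),
      (∃ i, r0 < i ∧ d i c0 = true) ∧ 
      ∀ i ∈ S, (∃ j, d i j = true) ∧ ∀ j ∈ T, (∃ i, d i j = true) ∧ (d i j = true → 
        (Xor (∃ i', i' < i ∧ d i' j = true) (∃ j', j' < j ∧ d i j' = true)) ∧
        ((∃ i', i < i' ∧ d i' j = true) ↔ (∃ j', j < j' ∧ d i j' = true))) := by
    intro α β _ _ _ _ r0 c0 hr hc d S T hS hT hd h0 h
    have hneS : ∀ i ∈ S, i ≠ r0 := fun i hi e => hS (e ▸ hi)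
    have cS : ∀ i ∈ S, ∀ j, d i j = true → j ∈ T := fun i hi j hij =>
      (hd i j hij (fun x => hneS i hi x.1)).1 hi
    have cT : ∀ j ∈ T, ∀ i, d i j = true → i ≠ r0 ∨ j ≠ c0 → i ∈ S := fun j hj i hij hn =>
      (hd i j hij (by tauto)).2 hj
    refine ⟨?_, ?_⟩
    · obtain ⟨i, hi⟩ := h.col ⟨c0, hT⟩
      exact ⟨i, lt_of_le_of_ne (hr i) (hneS i i.2).symm, hi⟩
    · intro i hi
      refine ⟨?_, fun j hj => ⟨?_, fun hij => ⟨?_, ?_⟩⟩⟩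
      · obtain ⟨j, hj⟩ := h.row ⟨i, hi⟩; exact ⟨j, hj⟩
      · obtain ⟨i, hi⟩ := h.col ⟨j, hj⟩; exact ⟨i, hi⟩
      · have e2 : (∃ j' : T, j' < ⟨j, hj⟩ ∧ d i j' = true) ↔ ∃ j', j' < j ∧ d i j' = true :=
          ⟨fun ⟨j', a, b⟩ => ⟨j', a, b⟩, fun ⟨j', a, b⟩ => ⟨⟨j', cS i hi _ b⟩, a, b⟩⟩
        by_cases hjc : j = c0
        · subst hjc
          exact Or.inl ⟨⟨r0, lt_of_le_of_ne (hr i) (hneS i hi).symm, h0⟩, 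
            fun ⟨j', a, _⟩ => absurd (hc j') (not_le.2 a)⟩
        · have hx := h.nonamb ⟨i, hi⟩ ⟨j, hj⟩ hij 
            (fun x => hjc (le_antisymm (x.2 ⟨c0, hT⟩) (hc j)))
          have e1 : (∃ i' : S, i' < ⟨i, hi⟩ ∧ d i' j = true) ↔ ∃ i', i' < i ∧ d i' j = true :=
            ⟨fun ⟨j', a, b⟩ => ⟨j', a, b⟩, fun ⟨i', a, b⟩ => 
              ⟨⟨i', cT j hj _ b (Or.inr hjc)⟩, a, b⟩⟩
          simp only [e1, e2] at hx; exact hx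
      · have hx := h.compl ⟨i, hi⟩ ⟨j, hj⟩ hij
        have e2 : (∃ j' : T, ⟨j, hj⟩ < j' ∧ d i j' = true) ↔ ∃ j', j < j' ∧ d i j' = true :=
          ⟨fun ⟨j', a, b⟩ => ⟨j', a, b⟩, fun ⟨j', a, b⟩ => ⟨⟨j', cS i hi _ b⟩, a, b⟩⟩
        have e1 : (∃ i' : S, ⟨i, hi⟩ < i' ∧ d i' j = true) ↔ ∃ i', i < i' ∧ d i' j = true :=
          ⟨fun ⟨j', a, b⟩ => ⟨j', a, b⟩, fun ⟨i', a, b⟩ =>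
            ⟨⟨i', cT j hj _ b (Or.inl ((hr i).trans_lt a).ne')⟩, a, b⟩⟩
        simp only [e1, e2] at hx; exact hx
  obtain ⟨l1, l2⟩ := half hr hc hS hT hd h0 hL
  obtain ⟨r1, r2⟩ := half hc hr (by simpa using hT) (by simpa using hS) hd.transpose h0 hR.transpose
  simp only [Finset.mem_compl] at r2
  have hsplit : ∀ i j, d i j = true → (i = r0 ∧ j = c0) ∨ (i ∈ S ∧ j ∈ T) ∨ (i ∉ S ∧ j ∉ T) := by
    intro i j hij
    have := hd i j hij
    tauto
  obtain ⟨iS, hiS⟩ : ∃ i, i ∈ S := by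
    obtain ⟨i, -⟩ := hL.col ⟨c0, hT⟩; exact ⟨i, i.2⟩
  obtain ⟨jT, hjT⟩ : ∃ j, j ∉ T := by
    obtain ⟨j, -⟩ := hR.row ⟨r0, by simpa using hS⟩; exact ⟨j, Finset.mem_compl.1 j.2⟩
  refine ⟨?_, ?_, ?_, ?_, ?_⟩
  · intro i j hi hj
    rw [(bot_iff hr i).1 hi, (bot_iff hc j).1 hj]; exact h0
  · intro i j hij hn
    rw [bot_iff hr, bot_iff hc] at hn
    rcases hsplit i j hij with h | h | h
    · exact absurd h hn
    · exact (((l2 i h.1).2 j h.2).2 hij).1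
    · exact (((r2 j h.2).2 i h.1).2 hij).1.symm
  · intro i
    by_cases hi : i ∈ S
    · exact (l2 i hi).1
    · exact ((r2 jT hjT).2 i hi).1
  · intro j
    by_cases hj : j ∈ T
    · exact ((l2 iS hiS).2 j hj).1
    · exact (r2 j hj).1
  · intro i j hij
    rcases hsplit i j hij with ⟨rfl, rfl⟩ | h | h
    · exact ⟨fun _ => r1, fun _ => l1⟩
    · exact (((l2 i h.1).2 j h.2).2 hij).2
    · exact (((r2 j h.2).2 i h.1).2 hij).2.symm

theorem IsC.card_le [Fintype α] [Fintype β] {d : α → β → Bool} (h : IsC d) :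
    Fintype.card α ≤ Fintype.card β := by
  have hmax : ∀ i, ∃ j, d i j = true ∧ ∀ j', d i j' = true → ¬ j < j' := fun i =>
    WellFounded.has_min (wellFounded_gt (α := β)) {x | d i x = true} (h.row i)
  choose f hf hfm using hmax
  apply Fintype.card_le_of_injective f
  have aux : ∀ a b, f a = f b → ¬ a < b := by
    intro a b hab hlt
    obtain ⟨j', hj', hd⟩ := (h.compl a (f a) (hf a)).1 ⟨b, hlt, hab ▸ hf b⟩
    exact hfm a j' hd hj'
  intro a b hab
  exact le_antisymm (not_lt.1 (aux b a hab.symm)) (not_lt.1 (aux a b hab))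

theorem IsC.card_eq [Fintype α] [Fintype β] {d : α → β → Bool} (h : IsC d) :
    Fintype.card α = Fintype.card β := le_antisymm h.card_le h.transpose.card_le

theorem Compat_s2.unique [Fintype α] [Fintype β] {r0 : α} {c0 : β} (hr : IsBot r0) (hc : IsBot c0)
    {d : α → β → Bool} {S S' : Finset α} {T T' : Finset β} (h : IsC d) 
    (hS : r0 ∉ S) (hT : c0 ∈ T) (hd : Compat_s2 r0 c0 d S T)
    (hS' : r0 ∉ S') (hT' : c0 ∈ T') (hd' : Compat_s2 r0 c0 d S' T') : S = S' ∧ T = T' := by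
  have hq : ∀ c, c ∈ T ↔ c ∈ T' := by
    intro c
    induction c using WellFoundedLT.induction with
    | ind c ih =>
    by_cases hcc : c = c0
    · subst hcc; tauto
    obtain ⟨r, hrc, hrmin⟩ := WellFounded.has_min (wellFounded_lt (α := α)) {x | d x c = true} (h.col c)
    have a1 := hd r c hrc (fun x => hcc x.2)
    have a2 := hd' r c hrc (fun x => hcc x.2)
    by_cases hrr : r = r0
    · subst hrr; tauto
    rcases h.nonamb r c hrc (fun x => hrr ((bot_iff hr r).1 x.1)) with ⟨⟨i', hi', hdi⟩, _⟩ | ⟨⟨j', hj', hdj⟩, _⟩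
    · exact absurd hi' (hrmin i' hdi)
    · have b1 := hd r j' hdj (fun x => hrr x.1)
      have b2 := hd' r j' hdj (fun x => hrr x.1)
      have := ih j' hj'
      tauto
  refine ⟨?_, Finset.ext hq⟩
  ext r
  by_cases hrr : r = r0
  · subst hrr; tauto
  obtain ⟨c, hrc⟩ := h.row r
  have b1 := hd r c hrc (fun x => hrr x.1)
  have b2 := hd' r c hrc (fun x => hrr x.1)
  have := hq c
  tauto
end

def colq {n : ℕ} (top left : Fin n → Fin n) (r0 c0 : Fin n) (c : Fin n) : Bool :=
  if c = c0 then true else if top c = r0 then false else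
    if _h : left (top c) < c then colq top left r0 c0 (left (top c)) else false
termination_by c.val

theorem Compat_s2.exists {n : ℕ} {r0 c0 : Fin n} (hr : IsBot r0) (hc : IsBot c0)
    {d : Fin n → Fin n → Bool} (h : IsC d) :
    ∃ S T : Finset (Fin n), r0 ∉ S ∧ c0 ∈ T ∧ Compat_s2 r0 c0 d S T := by
  have htop : ∀ c, ∃ r, d r c = true ∧ ∀ r', d r' c = true → ¬ r' < r := fun c =>
    WellFounded.has_min (wellFounded_lt (α := Fin n)) {x | d x c = true} (h.col c)
  have hleft : ∀ r, ∃ c, d r c = true ∧ ∀ c', d r c' = true → ¬ c' < c := fun r =>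
    WellFounded.has_min (wellFounded_lt (α := Fin n)) {x | d r x = true} (h.row r)
  choose top ht htm using htop
  choose left hl hlm using hleft
  refine ⟨Finset.univ.filter fun r => r ≠ r0 ∧ colq top left r0 c0 (left r) = true,
    Finset.univ.filter fun c => colq top left r0 c0 c = true, by simp, ?_, ?_⟩
  · rw [Finset.mem_filter, colq.eq_1]; simp
  · intro i j hij hn
    simp only [Finset.mem_filter, Finset.mem_univ, true_and]
    have hx := h.nonamb i j hij (by rwa [bot_iff hr, bot_iff hc])
    have hroot := h.root _ _ hr hc
    rcases hx with ⟨⟨i', hi', hdi⟩, hno⟩ | ⟨⟨j', hj', hdj⟩, hno⟩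
    · have e : left i = j := by
        refine le_antisymm (not_lt.1 (hlm i j hij)) (not_lt.1 fun hlt => hno ⟨_, hlt, hl i⟩)
      rw [e]
      have : i ≠ r0 := ((hr i').trans_lt hi').ne'
      tauto
    · have e : top j = i := by
        refine le_antisymm (not_lt.1 (htm j i hij)) (not_lt.1 fun hlt => hno ⟨_, hlt, ht j⟩)
      have hj0 : j ≠ c0 := ((hc j').trans_lt hj').ne'
      rw [colq.eq_1 _ _ _ _ j, if_neg hj0, e]
      have : left i < j := lt_of_le_of_lt (not_lt.1 (hlm i j' hdj)) hj'
      rw [dif_pos this]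
      by_cases hi0 : i = r0 <;> simp [hi0]

open Classical in
noncomputable def XX (n : ℕ) : Finset (Fin n → Fin n → Bool) := Finset.univ.filter fun d => IsC d

def mat {n : ℕ} (d : Fin n → Fin n → Bool) : Matrix (Fin n) (Fin n) ℤ :=
  Matrix.of fun i j => if d i j then (1 : ℤ) else 0

noncomputable def WW (n : ℕ) : ℤ := ∑ d ∈ XX n, (mat d).det

theorem mem_XX {n : ℕ} {d : Fin n → Fin n → Bool} : d ∈ XX n ↔ IsC d := by
  simp [XX]

theorem det_mat {k l : ℕ} {r0 c0 : Fin (k+l)} (d : Fin (k+l) → Fin (k+l) → Bool)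
    (S T : Finset (Fin (k+l))) (hS : S.card = k) (hSc : Sᶜ.card = l) (hT : T.card = k)
    (hTc : Tᶜ.card = l) (h0 : r0 ∉ S) (hd : Compat_s2 r0 c0 d S T) :
    (mat d).det = (-1) ^ (∑ i ∈ S, (i : ℕ)) * (-1) ^ (∑ i ∈ T, (i : ℕ)) *
      ((mat fun a b => d (S.orderEmbOfFin hS a) (T.orderEmbOfFin hT b)).det *
       (mat fun a b => d (Sᶜ.orderEmbOfFin hSc a) (Tᶜ.orderEmbOfFin hTc b)).det) := by
  rw [det_block (mat d) S T hS hSc hT hTc]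
  · rfl
  · intro i hi j hj
    simp only [mat, Matrix.of_apply]
    rw [if_neg]
    intro hij
    exact hj ((hd i j hij (fun x => h0 (x.1 ▸ hi))).1 hi)

theorem bot0 {n : ℕ} (h : 0 < n) : IsBot (⟨0, h⟩ : Fin n) := fun i => Nat.zero_le _

theorem IsC.sub {n k : ℕ} (S T : Finset (Fin n)) (hS : S.card = k) (hT : T.card = k)
    (d : Fin n → Fin n → Bool) :
    IsC (fun a b => d (S.orderEmbOfFin hS a) (T.orderEmbOfFin hT b)) ↔
      IsC (fun (i : S) (j : T) => d i j) :=
  IsC.congr (S.orderIsoOfFin hS) (T.orderIsoOfFin hT) (d := fun (i : S) (j : T) => d i j)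

theorem det_pm (n : ℕ) : ∀ d : Fin n → Fin n → Bool, IsC d →
    (mat d).det = 1 ∨ (mat d).det = -1 := by
  induction n using Nat.strong_induction_on with
  | _ n ih =>
  intro d h
  rcases Nat.lt_or_ge n 2 with hn | hn
  · left
    interval_cases n
    · simp
    · rw [Matrix.det_unique]
      have := h.root default default (fun i => (Subsingleton.elim _ _).le)
        (fun i => (Subsingleton.elim _ _).le)
      simp only [mat, Matrix.of_apply, this, if_true]
  · have hpos : 0 < n := by omega
    obtain ⟨S, T, hS, hT, hd⟩ := Compat_s2.exists (bot0 hpos) (bot0 hpos) h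
    have : Nontrivial (Fin n) := Fin.nontrivial_iff_two_le.2 hn
    have hL := h.left (bot0 hpos) (bot0 hpos) hS hT hd
    have hR := h.right (bot0 hpos) (bot0 hpos) hS hT hd
    have hc := hL.card_eq
    simp only [Fintype.card_coe] at hc
    obtain ⟨k, hk⟩ : ∃ k, S.card = k := ⟨_, rfl⟩
    obtain ⟨l, hl⟩ : ∃ l, Sᶜ.card = l := ⟨_, rfl⟩
    have hkl : n = k + l := by
      rw [← hk, ← hl, Finset.card_add_card_compl, Fintype.card_fin]
    subst hkl
    have hk' : T.card = k := by omega
    have hl' : Tᶜ.card = l := by rw [Finset.card_compl, Fintype.card_fin]; omega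
    have hk1 : 0 < k := hk' ▸ Finset.card_pos.2 ⟨_, hT⟩
    have hl1 : 0 < l := hl ▸ Finset.card_pos.2 ⟨_, Finset.mem_compl.2 hS⟩
    rw [det_mat d S T hk hl hk' hl' hS hd]
    have p1 := ih k (by omega) _ ((IsC.sub S T hk hk' d).2 hL)
    have p2 := ih l (by omega) _ ((IsC.sub Sᶜ Tᶜ hl hl' d).2 hR)
    rcases neg_one_pow_eq_or ℤ (∑ i ∈ S, (i : ℕ)) with q1 | q1 <;>
    rcases neg_one_pow_eq_or ℤ (∑ i ∈ T, (i : ℕ)) with q2 | q2 <;>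
    rcases p1 with p1 | p1 <;> rcases p2 with p2 | p2 <;> rw [q1, q2, p1, p2] <;> simp

/-- glue two fillings and the root -/
noncomputable def glue {n k l : ℕ} (r0 c0 : Fin n) (S T : Finset (Fin n)) (hS : S.card = k)
    (hSc : Sᶜ.card = l) (hT : T.card = k) (hTc : Tᶜ.card = l)
    (dL : Fin k → Fin k → Bool) (dR : Fin l → Fin l → Bool) (i j : Fin n) : Bool :=
  if i = r0 ∧ j = c0 then true else
  if h : i ∈ S ∧ j ∈ T then
    dL ((S.orderIsoOfFin hS).symm ⟨i, h.1⟩) ((T.orderIsoOfFin hT).symm ⟨j, h.2⟩)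
  else if h : i ∈ Sᶜ ∧ j ∈ Tᶜ then
    dR ((Sᶜ.orderIsoOfFin hSc).symm ⟨i, h.1⟩) ((Tᶜ.orderIsoOfFin hTc).symm ⟨j, h.2⟩)
  else false

section
variable {n k l : ℕ} {r0 c0 : Fin n} {S T : Finset (Fin n)} (hS : S.card = k)
    (hSc : Sᶜ.card = l) (hT : T.card = k) (hTc : Tᶜ.card = l)
    (dL : Fin k → Fin k → Bool) (dR : Fin l → Fin l → Bool)

theorem glue_L (h0 : r0 ∉ S) (a b : Fin k) :
    glue r0 c0 S T hS hSc hT hTc dL dR (S.orderEmbOfFin hS a) (T.orderEmbOfFin hT b) = dL a b := by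
  have h1 := S.orderEmbOfFin_mem hS a
  have h2 := T.orderEmbOfFin_mem hT b
  unfold glue
  have hn : ¬ (S.orderEmbOfFin hS a = r0 ∧ T.orderEmbOfFin hT b = c0) := fun x => h0 (x.1 ▸ h1)
  rw [if_neg hn, dif_pos ⟨h1, h2⟩]
  congr 1
  · exact (S.orderIsoOfFin hS).symm_apply_apply a
  · exact (T.orderIsoOfFin hT).symm_apply_apply b

theorem glue_R (h0 : c0 ∈ T) (a b : Fin l) :
    glue r0 c0 S T hS hSc hT hTc dL dR (Sᶜ.orderEmbOfFin hSc a) (Tᶜ.orderEmbOfFin hTc b)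
      = dR a b := by
  have h1 := Sᶜ.orderEmbOfFin_mem hSc a
  have h2 := Tᶜ.orderEmbOfFin_mem hTc b
  unfold glue
  have hn : ¬ (Sᶜ.orderEmbOfFin hSc a = r0 ∧ Tᶜ.orderEmbOfFin hTc b = c0) :=
    fun x => Finset.mem_compl.1 h2 (by rw [x.2]; exact h0)
  rw [if_neg hn, dif_neg (fun x => Finset.mem_compl.1 h1 x.1), dif_pos ⟨h1, h2⟩]
  congr 1
  · exact (Sᶜ.orderIsoOfFin hSc).symm_apply_apply a
  · exact (Tᶜ.orderIsoOfFin hTc).symm_apply_apply b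

theorem glue_compat : Compat_s2 r0 c0 (glue r0 c0 S T hS hSc hT hTc dL dR) S T := by
  intro i j hij hn
  unfold glue at hij
  rw [if_neg hn] at hij
  split_ifs at hij with h1 h2
  · tauto
  · simp only [Finset.mem_compl] at h2; tauto

theorem glue_isC (hr : IsBot r0) (hc : IsBot c0) (h0 : r0 ∉ S) (h1 : c0 ∈ T)
    (hL : IsC dL) (hR : IsC dR) : IsC (glue r0 c0 S T hS hSc hT hTc dL dR) := by
  apply IsC.combine hr hc h0 h1 (glue_compat hS hSc hT hTc dL dR)
  · simp [glue]
  · rw [← IsC.sub S T hS hT]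
    simpa only [glue_L hS hSc hT hTc dL dR h0] using hL
  · rw [← IsC.sub Sᶜ Tᶜ hSc hTc]
    simpa only [glue_R hS hSc hT hTc dL dR h1] using hR

theorem glue_eta (d : Fin n → Fin n → Bool) (hd : Compat_s2 r0 c0 d S T) (h0 : d r0 c0 = true) :
    glue r0 c0 S T hS hSc hT hTc
      (fun a b => d (S.orderEmbOfFin hS a) (T.orderEmbOfFin hT b))
      (fun a b => d (Sᶜ.orderEmbOfFin hSc a) (Tᶜ.orderEmbOfFin hTc b)) = d := by
  funext i j
  unfold glue
  split_ifs with h1 h2 h3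
  · rw [h1.1, h1.2, h0]
  · simp only [← Finset.coe_orderIsoOfFin_apply, OrderIso.apply_symm_apply]
  · simp only [← Finset.coe_orderIsoOfFin_apply, OrderIso.apply_symm_apply]
  · have := hd i j
    simp only [Finset.mem_compl] at h3
    cases hij : d i j
    · rfl
    · have := this hij h1; tauto
end

open Classical in
theorem fiber_sum {k l : ℕ} {r0 c0 : Fin (k+l)} (hr : IsBot r0) (hc : IsBot c0)
    (S T : Finset (Fin (k+l))) (hS : S.card = k) (hSc : Sᶜ.card = l) (hT : T.card = k)
    (hTc : Tᶜ.card = l) (h0 : r0 ∉ S) (h1 : c0 ∈ T) :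
    ∑ d ∈ (XX (k+l)).filter (fun d => Compat_s2 r0 c0 d S T), (mat d).det =
      (-1) ^ (∑ i ∈ S, (i : ℕ)) * (-1) ^ (∑ i ∈ T, (i : ℕ)) * (WW k * WW l) := by
  have hk1 : 0 < k := hT ▸ Finset.card_pos.2 ⟨_, h1⟩
  have hl1 : 0 < l := hSc ▸ Finset.card_pos.2 ⟨_, Finset.mem_compl.2 h0⟩
  have : Nontrivial (Fin (k+l)) := Fin.nontrivial_iff_two_le.2 (by omega)
  rw [WW, WW, Finset.sum_mul_sum, ← Finset.sum_product', Finset.mul_sum]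
  refine Finset.sum_bij'
    (fun d _ => (fun a b => d (S.orderEmbOfFin hS a) (T.orderEmbOfFin hT b),
      fun a b => d (Sᶜ.orderEmbOfFin hSc a) (Tᶜ.orderEmbOfFin hTc b)))
    (fun p _ => glue r0 c0 S T hS hSc hT hTc p.1 p.2) ?_ ?_ ?_ ?_ ?_
  · intro d hd
    rw [Finset.mem_filter, mem_XX] at hd
    rw [Finset.mem_product, mem_XX, mem_XX]
    exact ⟨(IsC.sub S T hS hT d).2 (hd.1.left hr hc h0 h1 hd.2),
      (IsC.sub Sᶜ Tᶜ hSc hTc d).2 (hd.1.right hr hc h0 h1 hd.2)⟩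
  · intro p hp
    rw [Finset.mem_product, mem_XX, mem_XX] at hp
    rw [Finset.mem_filter, mem_XX]
    exact ⟨glue_isC hS hSc hT hTc _ _ hr hc h0 h1 hp.1 hp.2, glue_compat hS hSc hT hTc _ _⟩
  · intro d hd
    rw [Finset.mem_filter, mem_XX] at hd
    exact glue_eta hS hSc hT hTc d hd.2 (hd.1.root _ _ hr hc)
  · rintro ⟨dL, dR⟩ hp
    simp only [glue_L hS hSc hT hTc dL dR h0, glue_R hS hSc hT hTc dL dR h1]
  · intro d hd
    rw [Finset.mem_filter, mem_XX] at hd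
    exact det_mat d S T hS hSc hT hTc h0 hd.2

open Classical in
theorem WW_eq {n : ℕ} (hn : 2 ≤ n) {r0 : Fin n} (hr : IsBot r0) :
    WW n = ∑ S ∈ Finset.univ.filter (fun S : Finset (Fin n) => r0 ∉ S),
      ∑ T ∈ Finset.univ.filter (fun T : Finset (Fin n) => r0 ∈ T),
        if S.card = T.card then
          (-1) ^ (∑ i ∈ S, (i : ℕ)) * (-1) ^ (∑ i ∈ T, (i : ℕ)) * (WW S.card * WW (n - S.card))
        else 0 := by
  have : Nontrivial (Fin n) := Fin.nontrivial_iff_two_le.2 hn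
  have h1 : WW n = ∑ d ∈ XX n, ∑ S ∈ Finset.univ.filter (fun S : Finset (Fin n) => r0 ∉ S),
      ∑ T ∈ Finset.univ.filter (fun T : Finset (Fin n) => r0 ∈ T),
      if Compat_s2 r0 r0 d S T then (mat d).det else 0 := by
    unfold WW
    refine Finset.sum_congr rfl fun d hd => ?_
    rw [mem_XX] at hd
    obtain ⟨S, T, hS, hT, hc⟩ := Compat_s2.exists hr hr hd
    rw [Finset.sum_eq_single_of_mem S (by simpa using hS),
      Finset.sum_eq_single_of_mem T (by simpa using hT), if_pos hc]
    · intro T' hT' hne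
      rw [if_neg]
      intro hc'
      exact hne (Compat_s2.unique hr hr hd hS (by simpa using hT') hc' hS hT hc).2
    · intro S' hS' hne
      refine Finset.sum_eq_zero fun T' hT' => ?_
      rw [if_neg]
      intro hc'
      exact hne (Compat_s2.unique hr hr hd (by simpa using hS') (by simpa using hT') hc' hS hT hc).1
  rw [h1, Finset.sum_comm]
  refine Finset.sum_congr rfl fun S hS => ?_
  rw [Finset.sum_comm]
  refine Finset.sum_congr rfl fun T hT => ?_
  replace hS : r0 ∉ S := by simpa using hS
  replace hT : r0 ∈ T := by simpa using hT
  rw [← Finset.sum_filter]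
  split_ifs with hc
  · obtain ⟨k, hk⟩ : ∃ k, S.card = k := ⟨_, rfl⟩
    obtain ⟨l, hl⟩ : ∃ l, Sᶜ.card = l := ⟨_, rfl⟩
    have hkl : n = k + l := by
      rw [← hk, ← hl, Finset.card_add_card_compl, Fintype.card_fin]
    subst hkl
    have hk' : T.card = k := by omega
    have hl' : Tᶜ.card = l := by rw [Finset.card_compl, Fintype.card_fin]; omega
    rw [fiber_sum hr hr S T hk hl hk' hl' hS hT, hk, Nat.add_sub_cancel_left]
  · apply Finset.sum_eq_zero
    intro d hd
    rw [Finset.mem_filter, mem_XX] at hd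
    have := (hd.1.left hr hr hS hT hd.2).card_eq
    simp only [Fintype.card_coe] at this
    exact absurd this hc

theorem eo_eq (m k : ℕ) : (eCount m k : ℤ) - (oCount m k : ℤ) =
    ∑ U ∈ Finset.powersetCard k (Finset.Icc 1 m), (-1) ^ (∑ i ∈ U, i) := by
  unfold eCount oCount
  rw [Finset.card_filter, Finset.card_filter]
  push_cast
  rw [← Finset.sum_sub_distrib]
  refine Finset.sum_congr rfl fun U _ => ?_
  simp only [id]
  rcases Nat.even_or_odd (∑ i ∈ U, i) with h | h
  · simp [h, h.neg_one_pow, Nat.not_odd_iff_even.2 h]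
  · simp [h, h.neg_one_pow, Nat.not_even_iff_odd.2 h]

theorem sumS (m k : ℕ) :
    ∑ S ∈ Finset.univ.filter (fun S : Finset (Fin (m+1)) => 0 ∉ S ∧ S.card = k),
      (-1 : ℤ) ^ (∑ i ∈ S, (i : ℕ)) = (eCount m k : ℤ) - (oCount m k : ℤ) := by
  rw [eo_eq]
  refine Finset.sum_bij' (fun S _ => S.map Fin.valEmbedding)
    (fun U _ => Finset.univ.filter (fun i : Fin (m+1) => i.val ∈ U)) ?_ ?_ ?_ ?_ ?_
  · intro S hS
    simp only [Finset.mem_filter, Finset.mem_univ, true_and] at hS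
    rw [Finset.mem_powersetCard, Finset.card_map]
    refine ⟨?_, hS.2⟩
    intro x hx
    simp only [Finset.mem_map, Fin.valEmbedding_apply] at hx
    obtain ⟨i, hi, rfl⟩ := hx
    have : i ≠ 0 := fun e => hS.1 (e ▸ hi)
    have := Fin.pos_iff_ne_zero.2 this
    have h2 := i.2
    rw [Fin.lt_def] at this
    simp only [Fin.val_zero] at this
    rw [Finset.mem_Icc]; omega
  · intro U hU
    rw [Finset.mem_powersetCard] at hU
    simp only [Finset.mem_filter, Finset.mem_univ, true_and]
    refine ⟨fun h => ?_, ?_⟩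
    · have := Finset.mem_Icc.1 (hU.1 h); simp at this
    · rw [← hU.2, ← Finset.card_map Fin.valEmbedding]
      congr 1
      ext x
      simp only [Finset.mem_map, Finset.mem_filter, Finset.mem_univ, true_and, Fin.valEmbedding_apply]
      refine ⟨fun ⟨i, hi, e⟩ => e ▸ hi, fun hx => ?_⟩
      have := Finset.mem_Icc.1 (hU.1 hx)
      exact ⟨⟨x, by omega⟩, hx, rfl⟩
  · intro S hS
    ext i
    simp [Fin.val_inj]
  · intro U hU
    rw [Finset.mem_powersetCard] at hU
    ext x
    simp only [Finset.mem_map, Finset.mem_filter, Finset.mem_univ, true_and, Fin.valEmbedding_apply]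
    refine ⟨fun ⟨i, hi, e⟩ => e ▸ hi, fun hx => ?_⟩
    have := Finset.mem_Icc.1 (hU.1 hx)
    exact ⟨⟨x, by omega⟩, hx, rfl⟩
  · intro S hS
    simp

theorem sumT (m k : ℕ) (hk : 1 ≤ k) :
    ∑ T ∈ Finset.univ.filter (fun T : Finset (Fin (m+1)) => 0 ∈ T ∧ T.card = k),
      (-1 : ℤ) ^ (∑ i ∈ T, (i : ℕ)) = (eCount m (k-1) : ℤ) - (oCount m (k-1) : ℤ) := by
  rw [← sumS]
  refine Finset.sum_bij' (fun T _ => T.erase 0) (fun S _ => insert 0 S) ?_ ?_ ?_ ?_ ?_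
  · intro T hT
    simp only [Finset.mem_filter, Finset.mem_univ, true_and] at hT ⊢
    refine ⟨Finset.notMem_erase _ _, ?_⟩
    rw [Finset.card_erase_of_mem hT.1, hT.2]
  · intro S hS
    simp only [Finset.mem_filter, Finset.mem_univ, true_and] at hS ⊢
    refine ⟨Finset.mem_insert_self _ _, ?_⟩
    rw [Finset.card_insert_of_notMem hS.1, hS.2]; omega
  · intro T hT
    simp only [Finset.mem_filter, Finset.mem_univ, true_and] at hT
    exact Finset.insert_erase hT.1
  · intro S hS
    simp only [Finset.mem_filter, Finset.mem_univ, true_and] at hS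
    exact Finset.erase_insert hS.1
  · intro T hT
    rw [Finset.sum_erase]
    rfl

theorem WW_rec (m : ℕ) (hm : 1 ≤ m) : WW (m+1) = ∑ k ∈ Finset.Icc 1 m,
    WW k * WW (m + 1 - k) * ((eCount m (k - 1) : ℤ) - (oCount m (k - 1) : ℤ)) *
        ((eCount m k : ℤ) - (oCount m k : ℤ)) := by
  have hb : IsBot (0 : Fin (m+1)) := fun i => Fin.zero_le _
  rw [WW_eq (by omega) hb]
  have : ∀ k ∈ Finset.Icc 1 m, WW k * WW (m + 1 - k) *
      ((eCount m (k - 1) : ℤ) - (oCount m (k - 1) : ℤ)) * ((eCount m k : ℤ) - (oCount m k : ℤ)) =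
      ∑ S ∈ Finset.univ.filter (fun S : Finset (Fin (m+1)) => 0 ∉ S),
      ∑ T ∈ Finset.univ.filter (fun T : Finset (Fin (m+1)) => 0 ∈ T),
        if S.card = k then if T.card = k then
          (-1) ^ (∑ i ∈ S, (i : ℕ)) * (-1) ^ (∑ i ∈ T, (i : ℕ)) * (WW k * WW (m + 1 - k))
        else 0 else 0 := by
    intro k hk
    rw [Finset.mem_Icc] at hk
    have eS := sumS m k
    have eT := sumT m k hk.1
    rw [← Finset.filter_filter, Finset.sum_filter (p := fun S => Finset.card S = k)] at eS eT
    rw [← eS, ← eT, mul_assoc, mul_comm (Finset.sum _ _) (Finset.sum _ _), Finset.sum_mul_sum,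
      Finset.mul_sum]
    refine Finset.sum_congr rfl fun S _ => ?_
    rw [Finset.mul_sum]
    refine Finset.sum_congr rfl fun T _ => ?_
    split_ifs <;> ring
  rw [Finset.sum_congr rfl this, Finset.sum_comm (s := Finset.Icc 1 m)]
  refine Finset.sum_congr rfl fun S hS => ?_
  rw [Finset.sum_comm]
  refine Finset.sum_congr rfl fun T hT => ?_
  rw [Finset.sum_ite_eq]
  replace hS : (0 : Fin (m+1)) ∉ S := by simpa using hS
  replace hT : (0 : Fin (m+1)) ∈ T := by simpa using hT
  by_cases hc : S.card = T.card
  · rw [if_pos hc, if_pos, if_pos hc.symm]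
    have h1 : 0 < T.card := Finset.card_pos.2 ⟨_, hT⟩
    have h2 : S.card < m + 1 := by
      have := Finset.card_lt_univ_of_notMem hS
      rwa [Fintype.card_fin] at this
    rw [Finset.mem_Icc]; omega
  · rw [if_neg hc, if_neg (Ne.symm hc), ite_self]

theorem CNAT.isC {n : ℕ} (M : CNAT n) : IsC M.dot := by
  have hb : ∀ i : Fin n, IsBot i ↔ i.val = 0 := fun i =>
    ⟨fun h => Nat.le_zero.1 (h ⟨0, i.pos⟩), fun h j => by rw [Fin.le_def, h]; exact Nat.zero_le _⟩
  refine ⟨?_, ?_, M.min_row, M.min_col, M.complete⟩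
  · intro i j hi hj
    have h1 : i = ⟨0, i.pos⟩ := Fin.ext ((hb i).1 hi)
    have h2 : j = ⟨0, i.pos⟩ := Fin.ext ((hb j).1 hj)
    rw [h1, h2]; exact M.root _
  · intro i j hij hn
    rw [hb, hb] at hn
    exact M.nonambiguous i j hij hn

def CNAT.ofIsC {n : ℕ} (d : Fin n → Fin n → Bool) (h : IsC d) : CNAT n where
  dot := d
  root hn := h.root _ _ (bot0 hn) (bot0 hn)
  nonambiguous i j hij hn := h.nonamb i j hij (fun x => hn
    ⟨Nat.le_zero.1 (x.1 ⟨0, i.pos⟩), Nat.le_zero.1 (x.2 ⟨0, i.pos⟩)⟩)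
  min_row := h.row
  min_col := h.col
  complete := h.compl

theorem card_cnat (n : ℕ) (z : ℤ) : Nat.card {M : CNAT n // cnatDet M = z} =
    ((XX n).filter fun d => (mat d).det = z).card := by
  rw [← Nat.card_eq_finsetCard]
  refine Nat.card_congr
    { toFun := fun M => ⟨M.1.dot, Finset.mem_filter.2 ⟨mem_XX.2 M.1.isC, M.2⟩⟩
      invFun := fun d => ⟨CNAT.ofIsC d.1 (mem_XX.1 (Finset.mem_filter.1 d.2).1),
        (Finset.mem_filter.1 d.2).2⟩
      left_inv := fun M => rfl
      right_inv := fun d => rfl }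

theorem cnatD_eq (n : ℕ) : cnatD n = WW n := by
  unfold cnatD cnatA cnatB WW
  rw [card_cnat, card_cnat, Finset.card_filter, Finset.card_filter]
  push_cast
  rw [← Finset.sum_sub_distrib]
  refine Finset.sum_congr rfl fun d hd => ?_
  rcases det_pm n d (mem_XX.1 hd) with h | h <;> simp [h]

theorem cnat_D_recurrence (n : ℕ) (hn : 2 ≤ n) :
    cnatD n = ∑ k ∈ Finset.Icc 1 (n - 1),
      cnatD k * cnatD (n - k) *
        ((eCount (n - 1) (k - 1) : ℤ) - (oCount (n - 1) (k - 1) : ℤ)) *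
        ((eCount (n - 1) k : ℤ) - (oCount (n - 1) k : ℤ)) := by
  obtain ⟨m, rfl⟩ : ∃ m, n = m + 1 := ⟨n - 1, by omega⟩
  simp only [cnatD_eq]
  exact WW_rec m (by omega)
end

section
/- For all natural numbers n ≥ 1 and integers k with 0 ≤ k ≤ n−1, the number of (2k)-element subsets of {1, …, 2n−1} with even element sum minus the number with odd element sum equals (−1)^k · binomial(n−1, k); that is, e^{2n−1}_{2k} − o^{2n−1}_{2k} = (−1)^k · C(n−1, k). -/
/-- signed count of `k`-subsets of `{1, …, m}`. -/
def sCount (m k : ℕ) : ℤ :=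
  ∑ S ∈ Finset.powersetCard k (Finset.Icc 1 m), (-1 : ℤ) ^ (S.sum id)

theorem eCount_sub_oCount_eq (m k : ℕ) :
    (eCount m k : ℤ) - (oCount m k : ℤ) = sCount m k := by
  unfold eCount oCount sCount
  rw [Finset.card_filter, Finset.card_filter]
  push_cast
  rw [← Finset.sum_sub_distrib]
  refine Finset.sum_congr rfl fun S _ => ?_
  rcases Nat.even_or_odd (S.sum id) with h | h
  · rw [if_pos h, if_neg (Nat.not_odd_iff_even.2 h), h.neg_one_pow]; rfl
  · rw [if_neg (Nat.not_even_iff_odd.2 h), if_pos h, h.neg_one_pow]; rfl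

theorem sCount_zero (m : ℕ) : sCount m 0 = 1 := by
  simp [sCount]

theorem sCount_succ (m k : ℕ) :
    sCount (m + 1) (k + 1) = sCount m (k + 1) + (-1) ^ (m + 1) * sCount m k := by
  unfold sCount
  have hnot : m + 1 ∉ Finset.Icc 1 m := by simp
  have hI : Finset.Icc 1 (m + 1) = insert (m + 1) (Finset.Icc 1 m) := by
    ext x; simp only [Finset.mem_Icc, Finset.mem_insert]; omega
  have hmem : ∀ j, ∀ S ∈ Finset.powersetCard j (Finset.Icc 1 m), m + 1 ∉ S := fun j S hS h =>
    hnot ((Finset.mem_powersetCard.1 hS).1 h)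
  rw [hI, Finset.powersetCard_succ_insert hnot, Finset.sum_union, Finset.sum_image,
    Finset.mul_sum]
  · congr 1
    refine Finset.sum_congr rfl fun S hS => ?_
    rw [Finset.sum_insert (hmem k S hS), pow_add]; rfl
  · intro S hS T hT h
    rw [← Finset.erase_insert (hmem k S hS), ← Finset.erase_insert (hmem k T hT)]
    exact congrArg (fun U => Finset.erase U (m + 1)) h
  · rw [Finset.disjoint_left]
    intro S hS hT
    obtain ⟨T, _, rfl⟩ := Finset.mem_image.1 hT
    exact hmem _ _ hS (Finset.mem_insert_self _ _)

theorem sCount_odd (j : ℕ) : ∀ k, sCount (2 * j + 1) (2 * k) = (-1) ^ k * (j.choose k : ℤ) := by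
  induction j with
  | zero =>
    intro k
    rcases k with _ | k
    · simp [sCount_zero]
    · have : Finset.powersetCard (2 * (k + 1)) (Finset.Icc 1 1) = ∅ := by
        apply Finset.powersetCard_eq_empty.2
        simp; omega
      rw [sCount, Nat.mul_zero, Nat.zero_add, this]; simp
  | succ j ih =>
    intro k
    rcases k with _ | k
    · simp [sCount_zero]
    · have h1 := sCount_succ (2 * j + 2) (2 * k + 1)
      have h2 := sCount_succ (2 * j + 1) (2 * k + 1)
      have h3 := sCount_succ (2 * j + 1) (2 * k)
      have e1 : (-1 : ℤ) ^ (2 * j + 2 + 1) = -1 := Odd.neg_one_pow ⟨j + 1, by ring⟩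
      have e2 : (-1 : ℤ) ^ (2 * j + 1 + 1) = 1 := Even.neg_one_pow ⟨j + 1, by ring⟩
      have i1 := ih k
      have i2 := ih (k + 1)
      rw [e1] at h1
      rw [e2] at h2 h3
      rw [show 2 * (k + 1) = 2 * k + 1 + 1 by ring] at i2 ⊢
      rw [show 2 * (j + 1) + 1 = 2 * j + 2 + 1 by ring, h1, h2, h3, i1, i2,
        Nat.choose_succ_succ]
      push_cast
      ring

theorem eCount_sub_oCount_even (n k : ℕ) (hn : 1 ≤ n) (hk : k ≤ n - 1) :
    (eCount (2 * n - 1) (2 * k) : ℤ) - (oCount (2 * n - 1) (2 * k) : ℤ) =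
      (-1 : ℤ) ^ k * (n - 1).choose k := by
  obtain ⟨j, rfl⟩ : ∃ j, n = j + 1 := ⟨n - 1, by omega⟩
  rw [eCount_sub_oCount_eq, show 2 * (j + 1) - 1 = 2 * j + 1 by omega, sCount_odd]
  rfl
end

section
/- For all natural numbers n ≥ 1 and integers k with 0 ≤ k ≤ n−1, the number of (2k+1)-element subsets of {1, …, 2n−1} with even element sum minus the number with odd element sum equals (−1)^{k+1} · binomial(n−1, k); that is, e^{2n−1}_{2k+1} − o^{2n−1}_{2k+1} = (−1)^{k+1} · C(n−1, k). -/
/-- Signed count of `k`-subsets of `{1, …, m}`. -/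
def signedCount (m k : ℕ) : ℤ :=
  ∑ S ∈ Finset.powersetCard k (Finset.Icc 1 m), (-1 : ℤ) ^ (S.sum id)

theorem signedCount_eq (m k : ℕ) :
    (eCount m k : ℤ) - (oCount m k : ℤ) = signedCount m k := by
  unfold eCount oCount signedCount
  rw [Finset.card_filter, Finset.card_filter]
  push_cast
  rw [← Finset.sum_sub_distrib]
  refine Finset.sum_congr rfl fun S _ => ?_
  rcases Nat.even_or_odd (S.sum id) with h | h
  · rw [if_pos h, if_neg (Nat.not_odd_iff_even.mpr h), h.neg_one_pow]; rfl
  · rw [if_neg (Nat.not_even_iff_odd.mpr h), if_pos h, h.neg_one_pow]; rfl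

theorem signedCount_zero (m : ℕ) : signedCount m 0 = 1 := by
  simp [signedCount]

theorem signedCount_succ (m k : ℕ) :
    signedCount (m + 1) (k + 1) =
      signedCount m (k + 1) + (-1) ^ (m + 1) * signedCount m k := by
  have hnot : m + 1 ∉ Finset.Icc 1 m := by simp
  have hmem : ∀ j, ∀ S ∈ Finset.powersetCard j (Finset.Icc 1 m), m + 1 ∉ S :=
    fun j S hS h => hnot ((Finset.mem_powersetCard.mp hS).1 h)
  have hI : Finset.Icc 1 (m + 1) = insert (m + 1) (Finset.Icc 1 m) := by
    ext x; simp only [Finset.mem_Icc, Finset.mem_insert]; omega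
  unfold signedCount
  rw [hI, Finset.powersetCard_succ_insert hnot, Finset.sum_union, Finset.sum_image]
  · congr 1
    rw [Finset.mul_sum]
    refine Finset.sum_congr rfl fun S hS => ?_
    rw [Finset.sum_insert (hmem k S hS), pow_add]; rfl
  · intro S hS T hT h
    rw [← Finset.erase_insert (hmem k S hS), ← Finset.erase_insert (hmem k T hT)]
    exact congrArg (fun U => Finset.erase U (m + 1)) h
  · rw [Finset.disjoint_left]
    intro S hS hS'
    obtain ⟨T, _, rfl⟩ := Finset.mem_image.mp hS'
    exact hmem _ _ hS (Finset.mem_insert_self _ _)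

theorem signedCount_empty (k : ℕ) : signedCount 0 (k + 1) = 0 := by
  unfold signedCount
  rw [Finset.powersetCard_eq_empty.mpr (by simp), Finset.sum_empty]

theorem signedCount_odd (n : ℕ) : ∀ k,
    signedCount (2 * n + 1) (2 * k + 1) = (-1 : ℤ) ^ (k + 1) * n.choose k := by
  induction n with
  | zero =>
    intro k
    rw [signedCount_succ, signedCount_empty]
    cases k with
    | zero => simp [signedCount_zero]
    | succ k => rw [show 2 * (k + 1) = 2 * k + 1 + 1 by ring, signedCount_empty]; simp
  | succ n ih =>
    intro k
    have h1 : (-1 : ℤ) ^ (2 * n + 1 + 1) = 1 := Even.neg_one_pow ⟨n + 1, by ring⟩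
    have h2 : (-1 : ℤ) ^ (2 * n + 1 + 1 + 1) = -1 := Odd.neg_one_pow ⟨n + 1, by ring⟩
    rw [show 2 * (n + 1) + 1 = 2 * n + 1 + 1 + 1 by ring]
    cases k with
    | zero =>
      have h := ih 0
      rw [signedCount_succ, signedCount_succ, h, h1, h2]
      simp [signedCount_zero]
    | succ k =>
      have ha := ih (k + 1)
      have hb := ih k
      rw [show 2 * (k + 1) + 1 = 2 * k + 1 + 1 + 1 by ring] at ha ⊢
      rw [signedCount_succ (2 * n + 1 + 1), signedCount_succ (2 * n + 1) (2 * k + 1 + 1),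
        signedCount_succ (2 * n + 1) (2 * k + 1), ha, hb, h1, h2, Nat.choose_succ_succ]
      push_cast
      ring

theorem eCount_sub_oCount_odd (n k : ℕ) (hn : 1 ≤ n) (hk : k ≤ n - 1) :
    (eCount (2 * n - 1) (2 * k + 1) : ℤ) - (oCount (2 * n - 1) (2 * k + 1) : ℤ) =
      (-1 : ℤ) ^ (k + 1) * (n - 1).choose k := by
  rw [signedCount_eq, show 2 * n - 1 = 2 * (n - 1) + 1 by omega, signedCount_odd]
end

section
/- For all natural numbers n ≥ 1 and integers k with 0 ≤ k ≤ n−1, the alternating sum over all (2k)-element subsets S of {1, …, 2n−1} of (−1)^{Σ_{s∈S} s} equals (−1)^k · binomial(n−1, k). -/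
/-- Signed count of the `j`-subsets of `{1, …, N}`. -/
def altSum (N j : ℕ) : ℤ :=
  ∑ S ∈ Finset.powersetCard j (Finset.Icc 1 N), (-1 : ℤ) ^ (∑ s ∈ S, s)

theorem altSum_zero (N : ℕ) : altSum N 0 = 1 := by
  simp [altSum]

theorem altSum_succ (N j : ℕ) :
    altSum (N + 1) (j + 1) = altSum N (j + 1) + (-1) ^ (N + 1) * altSum N j := by
  classical
  unfold altSum
  have hI : Finset.Icc 1 (N + 1) = insert (N + 1) (Finset.Icc 1 N) := by
    ext x; simp only [Finset.mem_Icc, Finset.mem_insert]; omega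
  have hn : N + 1 ∉ Finset.Icc 1 N := by simp
  have hmem : ∀ S ∈ Finset.powersetCard j (Finset.Icc 1 N), N + 1 ∉ S := fun S hS h =>
    hn ((Finset.mem_powersetCard.1 hS).1 h)
  rw [hI, Finset.powersetCard_succ_insert hn, Finset.sum_union, Finset.sum_image, Finset.mul_sum]
  · congr 1
    refine Finset.sum_congr rfl fun S hS => ?_
    rw [Finset.sum_insert (hmem S hS), pow_add]
  · intro S hS T hT h
    have h' := congrArg (fun U => Finset.erase U (N + 1)) h
    simpa [Finset.erase_insert (hmem S hS), Finset.erase_insert (hmem T hT)] using h'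
  · rw [Finset.disjoint_left]
    intro S hS hS'
    obtain ⟨T, _, rfl⟩ := Finset.mem_image.1 hS'
    exact hn ((Finset.mem_powersetCard.1 hS).1 (Finset.mem_insert_self _ _))

theorem altSum_odd (m : ℕ) : ∀ k, altSum (2 * m + 1) (2 * k) = (-1) ^ k * m.choose k := by
  induction m with
  | zero =>
    intro k
    cases k with
    | zero => simp [altSum_zero]
    | succ k =>
      have : Finset.powersetCard (2 * (k + 1)) (Finset.Icc 1 (2 * 0 + 1)) = ∅ :=
        Finset.powersetCard_eq_empty.2 (by simp; omega)
      rw [altSum, this]; simp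
  | succ m ih =>
    intro k
    cases k with
    | zero => simp [altSum_zero]
    | succ k =>
      have h1 := altSum_succ (2 * m + 2) (2 * k + 1)
      have h2 := altSum_succ (2 * m + 1) (2 * k + 1)
      have h3 := altSum_succ (2 * m + 1) (2 * k)
      have e1 : (-1 : ℤ) ^ (2 * m + 2 + 1) = -1 := Odd.neg_one_pow ⟨m + 1, by ring⟩
      have e2 : (-1 : ℤ) ^ (2 * m + 1 + 1) = 1 := Even.neg_one_pow ⟨m + 1, by ring⟩
      have i1 := ih k
      have i2 := ih (k + 1)
      rw [e1] at h1
      rw [e2] at h2 h3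
      change altSum (2 * m + 2 + 1) (2 * k + 1 + 1) = _
      change altSum (2 * m + 1) (2 * k + 1 + 1) = _ at i2
      change altSum (2 * m + 2) (2 * k + 1 + 1) = _ at h2
      change altSum (2 * m + 2) (2 * k + 1) = _ at h3
      rw [h1, h2, h3, i1, i2, Nat.choose_succ_succ]
      push_cast
      ring

theorem alternating_sum_even_card (n k : ℕ) (hn : 1 ≤ n) (hk : k ≤ n - 1) :
    ∑ S ∈ Finset.powersetCard (2 * k) (Finset.Icc 1 (2 * n - 1)),
        (-1 : ℤ) ^ (∑ s ∈ S, s) =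
      (-1 : ℤ) ^ k * (n - 1).choose k := by
  have h := altSum_odd (n - 1) k
  have e : 2 * (n - 1) + 1 = 2 * n - 1 := by omega
  rw [e] at h
  exact h
end

section
/- For all natural numbers n ≥ 1 and integers k with 0 ≤ k ≤ n−1, the alternating sum over all (2k+1)-element subsets S of {1, …, 2n−1} of (−1)^{Σ_{s∈S} s} equals (−1)^{k+1} · binomial(n−1, k). -/
def altE (m j : ℕ) : ℤ :=
  ∑ S ∈ Finset.powersetCard j (Finset.Icc 1 m), (-1 : ℤ) ^ (∑ s ∈ S, s)

lemma altE_zero (m : ℕ) : altE m 0 = 1 := by simp [altE]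

lemma altE_succ (m j : ℕ) :
    altE (m + 1) (j + 1) = altE m (j + 1) + (-1) ^ (m + 1) * altE m j := by
  unfold altE
  have hI : Finset.Icc 1 (m + 1) = insert (m + 1) (Finset.Icc 1 m) := by
    ext x; simp only [Finset.mem_Icc, Finset.mem_insert]; omega
  have hn : m + 1 ∉ Finset.Icc 1 m := by simp
  have hmem : ∀ (i : ℕ), ∀ S ∈ Finset.powersetCard i (Finset.Icc 1 m), m + 1 ∉ S := by
    intro i S hS h
    exact hn ((Finset.mem_powersetCard.1 hS).1 h)
  rw [hI, Finset.powersetCard_succ_insert hn, Finset.sum_union, Finset.sum_image,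
    Finset.mul_sum]
  · congr 1
    apply Finset.sum_congr rfl
    intro S hS
    rw [Finset.sum_insert (hmem _ S hS), pow_add]
  · intro S hS T hT h
    have h' : insert (m + 1) S = insert (m + 1) T := h
    rw [← Finset.erase_insert (hmem _ S hS), h', Finset.erase_insert (hmem _ T hT)]
  · rw [Finset.disjoint_left]
    intro S hS h
    obtain ⟨T, _, rfl⟩ := Finset.mem_image.1 h
    exact hmem _ _ hS (Finset.mem_insert_self _ _)

lemma altE_main (m : ℕ) : ∀ k, altE (2 * m + 1) (2 * k) = (-1) ^ k * (m.choose k : ℤ) ∧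
    altE (2 * m + 1) (2 * k + 1) = (-1) ^ (k + 1) * (m.choose k : ℤ) := by
  induction m with
  | zero =>
    have h0 : ∀ j, altE 0 (j + 1) = 0 := by intro j; rw [altE, Finset.powersetCard_eq_empty.2 (by simp)]; simp
    intro k
    cases k with
    | zero => simp [altE_zero, altE_succ 0 0, h0]
    | succ k =>
      have e : 2 * (k + 1) = (2 * k + 1) + 1 := by ring
      rw [e]
      simp [altE_succ, h0]
  | succ m ih =>
    have p1 : (-1 : ℤ) ^ (2 * m + 1 + 1) = 1 := Even.neg_one_pow ⟨m + 1, by ring⟩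
    have p2 : (-1 : ℤ) ^ (2 * m + 1 + 1 + 1) = -1 := Odd.neg_one_pow ⟨m + 1, by ring⟩
    have e : 2 * (m + 1) + 1 = 2 * m + 1 + 1 + 1 := by ring
    have step : ∀ j, altE (2 * (m + 1) + 1) (j + 2)
        = altE (2 * m + 1) (j + 2) - altE (2 * m + 1) j := by
      intro j
      rw [e, altE_succ (2 * m + 1 + 1) (j + 1), altE_succ (2 * m + 1) (j + 1), altE_succ (2 * m + 1) j, p1, p2]
      ring
    intro k
    cases k with
    | zero =>
      refine ⟨by simp [altE_zero], ?_⟩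
      have := (ih 0).2
      simp only [Nat.mul_zero] at this ⊢
      rw [e, altE_succ, altE_succ, p1, p2, this]
      simp [altE_zero]
    | succ k =>
      have a := ih k
      have b := ih (k + 1)
      have e1 : 2 * (k + 1) = 2 * k + 2 := by ring
      have e2 : 2 * k + 2 + 1 = (2 * k + 1) + 2 := by ring
      rw [e1, e2] at b ⊢
      rw [step, step, a.1, a.2, b.1, b.2, Nat.choose_succ_succ]
      push_cast
      constructor <;> ring

theorem alternating_sum_odd_card (n k : ℕ) (hn : 1 ≤ n) (hk : k ≤ n - 1) :
    ∑ S ∈ Finset.powersetCard (2 * k + 1) (Finset.Icc 1 (2 * n - 1)),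
        (-1 : ℤ) ^ (∑ s ∈ S, s) =
      (-1 : ℤ) ^ (k + 1) * (n - 1).choose k := by
  have h := (altE_main (n - 1) k).2
  have e : 2 * (n - 1) + 1 = 2 * n - 1 := by omega
  rw [e] at h
  exact h
end
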